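/- Let p be a prime, α ≥ 1, and r = p^α. Let d, k ≥ 1 be integers with p·r·k ≥ (r − 1)(d + 1) + 1. Let C_1, …, C_k be pairwise disjoint finite subsets of ℝ^d (the colors), each of cardinality (p + 1)r − 1. Then there exist pairwise disjoint subsets F_1, …, F_r of C_1 ∪ ⋯ ∪ C_k such that |F_s ∩ C_i| ≤ p for every s ∈ {1,…,r} and every i ∈ {1,…,k}, and the convex hulls of F_1, …, F_r have a common point: ⋂_{s=1}^r conv(F_s) ≠ ∅. -/

import Mathlib

open scoped Classical

namespace ListChain

/-- Ordered chains: formal combinations of finite sequences of points. A list of length `n` plays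
the role of a simplex of dimension `n - 1`; degenerate lists are allowed. -/
abbrev Chain (F X : Type*) [CommRing F] := List X →₀ F

variable {F : Type*} [CommRing F] {X Y : Type*}

/-- The cone operator, prepending a point. -/
noncomputable def cone (x : X) : Chain F X →ₗ[F] Chain F X :=
  Finsupp.lmapDomain F F (List.cons x)

/-- The map of chains induced by a map of points. -/
noncomputable def map (f : X → Y) : Chain F X →ₗ[F] Chain F Y :=
  Finsupp.lmapDomain F F (List.map f)

/-- The augmented boundary of a single list. -/
noncomputable def bdList : List X → Chain F X
  | [] => 0
  | x :: l => Finsupp.single l 1 - cone x (bdList l)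

/-- The augmented boundary operator. -/
noncomputable def bd : Chain F X →ₗ[F] Chain F X :=
  Finsupp.linearCombination F bdList

@[simp] lemma cone_single (x : X) (l : List X) (c : F) :
    cone x (Finsupp.single l c) = Finsupp.single (x :: l) c := by
  simp [cone]

@[simp] lemma map_single (f : X → Y) (l : List X) (c : F) :
    map f (Finsupp.single l c) = Finsupp.single (l.map f) c := by
  simp [map]

@[simp] lemma bd_single_nil : bd (Finsupp.single ([] : List X) (1 : F)) = 0 := by
  simp [bd, bdList]

lemma bd_single_cons (x : X) (l : List X) :
    bd (Finsupp.single (x :: l) (1 : F)) =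
      Finsupp.single l 1 - cone x (bd (Finsupp.single l 1)) := by
  simp [bd, bdList]

/-- Two linear maps on chains agree as soon as they agree on lists. -/
lemma hom_ext {M : Type*} [AddCommGroup M] [Module F M] {f g : Chain F X →ₗ[F] M}
    (h : ∀ l, f (Finsupp.single l 1) = g (Finsupp.single l 1)) : f = g :=
  Finsupp.lhom_ext' fun l => LinearMap.ext_ring (h l)

lemma bd_cone (x : X) (z : Chain F X) : bd (cone x z) = z - cone x (bd z) := by
  have : bd ∘ₗ cone x = LinearMap.id - cone x ∘ₗ (bd : Chain F X →ₗ[F] Chain F X) := by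
    refine hom_ext fun l => ?_
    simp [bd_single_cons]
  exact LinearMap.congr_fun this z

@[simp] lemma bd_bd (z : Chain F X) : bd (bd z) = 0 := by
  have : bd ∘ₗ bd = (0 : Chain F X →ₗ[F] Chain F X) := by
    refine hom_ext fun l => ?_
    induction l with
    | nil => simp
    | cons x l ih =>
      simp only [LinearMap.comp_apply, LinearMap.zero_apply] at ih
      simp [bd_single_cons, bd_cone, ih]
  exact LinearMap.congr_fun this z

lemma map_cone (f : X → Y) (x : X) (z : Chain F X) : map f (cone x z) = cone (f x) (map f z) := by
  have : map f ∘ₗ cone x = cone (f x) ∘ₗ (map f : Chain F X →ₗ[F] Chain F Y) :=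
    hom_ext fun l => by simp
  exact LinearMap.congr_fun this z

lemma bd_map (f : X → Y) (z : Chain F X) : bd (map f z) = map f (bd z) := by
  have : bd ∘ₗ map f = map f ∘ₗ (bd : Chain F X →ₗ[F] Chain F X) := by
    refine hom_ext fun l => ?_
    induction l with
    | nil => simp
    | cons x l ih =>
      simp only [LinearMap.comp_apply, map_single] at ih
      simp [bd_single_cons, map_cone, ih]
  exact LinearMap.congr_fun this z

lemma map_map {Z : Type*} (f : X → Y) (g : Y → Z) (z : Chain F X) :
    map g (map f z) = map (g ∘ f) z := by
  have : map g ∘ₗ map f = (map (g ∘ f) : Chain F X →ₗ[F] Chain F Z) :=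
    hom_ext fun l => by simp
  exact LinearMap.congr_fun this z

/-- The chains supported on a set of lists. -/
abbrev on (F : Type*) [CommRing F] (S : Set (List X)) : Submodule F (Chain F X) :=
  Finsupp.supported F F S

lemma map_mem_on_of_single {M : Type*} [AddCommGroup M] [Module F M] {S : Set (List X)}
    {P : Submodule F M} {f : Chain F X →ₗ[F] M}
    {z : Chain F X} (hz : z ∈ on F S) (h : ∀ l ∈ S, f (Finsupp.single l 1) ∈ P) : f z ∈ P := by
  have hle : on F S ≤ P.comap f := by
    rw [on, Finsupp.supported_eq_span_single, Submodule.span_le]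
    rintro _ ⟨l, hl, rfl⟩
    exact h l hl
  exact hle hz

lemma single_mem_on {S : Set (List X)} {l : List X} (h : l ∈ S) (c : F) :
    (Finsupp.single l c : Chain F X) ∈ on F S :=
  Finsupp.single_mem_supported F c h

lemma cone_mem_on {S T : Set (List X)} {x : X} {z : Chain F X} (hz : z ∈ on F S)
    (h : ∀ l ∈ S, x :: l ∈ T) : cone x z ∈ on F T :=
  map_mem_on_of_single hz fun l hl => by simpa using single_mem_on (h l hl) 1

/-- The boundary of a list is supported on its sublists with one element less. -/
lemma bd_single_mem_on (l : List X) :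
    bd (Finsupp.single l (1 : F)) ∈ on F {m | m.Sublist l ∧ m.length + 1 = l.length} := by
  induction l with
  | nil => simp
  | cons x l ih =>
    rw [bd_single_cons]
    refine Submodule.sub_mem _ (single_mem_on ?_ 1) ?_
    · exact ⟨List.sublist_cons_self x l, rfl⟩
    exact cone_mem_on ih fun m hm => ⟨hm.1.cons_cons x, by simpa using hm.2⟩

/-- A family of finite sets is down-closed. -/
def DownClosed (K : Set (Finset X)) : Prop := ∀ ⦃σ τ : Finset X⦄, τ ⊆ σ → σ ∈ K → τ ∈ K

/-- The simplices of `K` not containing a member of `𝓑`. -/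
def avoiding (K : Set (Finset X)) (𝓑 : Set (Finset X)) : Set (Finset X) :=
  {σ | σ ∈ K ∧ ∀ B ∈ 𝓑, ¬ B ⊆ σ}

variable [DecidableEq X]

/-- The chains of length `m` carried by a family `K` of finite sets. -/
abbrev chainsOf (F : Type*) [CommRing F] (K : Set (Finset X)) (m : ℕ) : Submodule F (Chain F X) :=
  on F {l | l.length = m ∧ l.toFinset ∈ K}

/-- Every cycle of length `m` carried by `K` bounds in `K`. -/
def Fills (F : Type*) [CommRing F] (K : Set (Finset X)) (m : ℕ) : Prop :=
  ∀ z ∈ chainsOf F K m, bd z = 0 → ∃ w ∈ chainsOf F K (m + 1), bd w = z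

lemma bd_mem_chainsOf {K : Set (Finset X)} (hK : DownClosed K) {m : ℕ} {z : Chain F X}
    (hz : z ∈ chainsOf F K (m + 1)) : bd z ∈ chainsOf F K m := by
  refine map_mem_on_of_single hz fun l hl => ?_
  refine Finsupp.supported_mono ?_ (bd_single_mem_on l)
  refine fun l' hl' => ⟨?_, hK ?_ hl.2⟩
  · have := hl'.2; have := hl.1; omega
  · intro x; simpa using fun h => hl'.1.subset h

lemma bd_of_mem_chainsOf_zero {K : Set (Finset X)} {z : Chain F X}
    (hz : z ∈ chainsOf F K 0) : bd z = 0 := by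
  have := map_mem_on_of_single (f := bd) (P := (⊥ : Submodule F (Chain F X))) hz fun l hl => ?_
  · simpa using this
  · obtain rfl : l = [] := List.length_eq_zero_iff.1 hl.1
    simp

lemma chainsOf_mono {K L : Set (Finset X)} (h : K ⊆ L) (m : ℕ) :
    chainsOf F K m ≤ chainsOf F L m :=
  Finsupp.supported_mono fun _ hl => ⟨hl.1, h hl.2⟩

lemma mem_chainsOf_inter {K L : Set (Finset X)} {m : ℕ} {z : Chain F X}
    (hK : z ∈ chainsOf F K m) (hL : z ∈ chainsOf F L m) : z ∈ chainsOf F (K ∩ L) m := by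
  rw [Finsupp.mem_supported] at *
  exact fun l hl => ⟨(hK hl).1, (hK hl).2, (hL hl).2⟩

lemma cone_mem_chainsOf {K L : Set (Finset X)} {x : X} {m : ℕ} {z : Chain F X}
    (hz : z ∈ chainsOf F K m) (h : ∀ σ ∈ K, insert x σ ∈ L) : cone x z ∈ chainsOf F L (m + 1) :=
  cone_mem_on hz fun l hl => ⟨by simp [hl.1], by simpa using h _ hl.2⟩

/-- The simplices joinable with `B` in `K` but not containing `B`. -/
def sphereAround (K : Set (Finset X)) (B : Finset X) : Set (Finset X) :=
  {σ | σ ∪ B ∈ K ∧ ¬ B ⊆ σ}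

/-- A cycle can be pushed off a face `B` if the part of the star of `B` that avoids `B` is acyclic
one dimension lower. -/
lemma push_off_face {K : Set (Finset X)} (hK : DownClosed K) {B : Finset X} (hB : B.Nonempty)
    {m : ℕ} (hfill : ∀ m', m = m' + 1 → Fills F (sphereAround K B) m') {z : Chain F X}
    (hz : z ∈ chainsOf F K m) (hbd : bd z = 0) :
    ∃ z' ∈ chainsOf F (avoiding K {B}) m, ∃ w ∈ chainsOf F K (m + 1), z = z' + bd w := by
  obtain ⟨b, hb⟩ := hB
  set z₁ : Chain F X := z.filter (fun l => B ⊆ l.toFinset) with hz₁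
  set z₀ : Chain F X := z.filter (fun l => ¬ B ⊆ l.toFinset) with hz₀
  have hsum : z₁ + z₀ = z := Finsupp.filter_add_filter_not z _
  rw [Finsupp.mem_supported] at hz
  have hav : DownClosed (avoiding K {B}) := fun σ τ h hσ =>
    ⟨hK h hσ.1, fun C hC hCτ => hσ.2 C hC (hCτ.trans h)⟩
  let St : Set (Finset X) := {σ | σ ∪ B ∈ K}
  have hSt : DownClosed St := fun σ τ h hσ => hK (Finset.union_subset_union_left h) hσ
  have hStK : St ⊆ K := fun σ hσ => hK Finset.subset_union_left hσ
  have h₀ : z₀ ∈ chainsOf F (avoiding K {B}) m := by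
    rw [Finsupp.mem_supported]
    intro l hl
    simp only [hz₀, Finset.mem_coe, Finsupp.support_filter, Finset.mem_filter] at hl
    exact ⟨(hz hl.1).1, (hz hl.1).2, by rintro C rfl; exact hl.2⟩
  have h₁ : z₁ ∈ chainsOf F St m := by
    rw [Finsupp.mem_supported]
    intro l hl
    simp only [hz₁, Finset.mem_coe, Finsupp.support_filter, Finset.mem_filter] at hl
    exact ⟨(hz hl.1).1, by simpa [St, Finset.union_eq_left.2 hl.2] using (hz hl.1).2⟩
  have hfin : ∀ y ∈ chainsOf F (avoiding K {B}) m, y ∈ chainsOf F St m → bd (z₁ + y) = 0 →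
      ∃ z' ∈ chainsOf F (avoiding K {B}) m, ∃ w ∈ chainsOf F K (m + 1), z = z' + bd w := by
    intro y hy hy' hzy
    refine ⟨z₀ - y, Submodule.sub_mem _ h₀ hy, cone b (z₁ + y),
      chainsOf_mono hStK _ (cone_mem_chainsOf (Submodule.add_mem _ h₁ hy') ?_), ?_⟩
    · intro σ hσ
      simpa [St, Finset.insert_union, Finset.mem_union_right σ hb] using hσ
    · rw [bd_cone, hzy, ← hsum]; simp; abel
  rcases m with _ | m
  · exact hfin 0 (Submodule.zero_mem _) (Submodule.zero_mem _)
      (by simpa using bd_of_mem_chainsOf_zero h₁)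
  · have e : bd z₁ = - bd z₀ := by
      rw [← hsum, map_add] at hbd; exact eq_neg_of_add_eq_zero_left hbd
    have hsph : avoiding K {B} ∩ St = sphereAround K B := by
      ext σ
      simp only [avoiding, St, sphereAround, Set.mem_inter_iff, Set.mem_ofPred_eq,
        Set.mem_singleton_iff, forall_eq]
      exact ⟨fun h => ⟨h.2, h.1.2⟩, fun h => ⟨⟨hStK h.1, h.2⟩, h.1⟩⟩
    have hin : bd z₁ ∈ chainsOf F (sphereAround K B) m := by
      rw [← hsph]
      refine mem_chainsOf_inter ?_ (bd_mem_chainsOf hSt h₁)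
      rw [e]; exact Submodule.neg_mem _ (bd_mem_chainsOf hav h₀)
    obtain ⟨w, hw, hwz⟩ := hfill m rfl _ hin (by simp)
    rw [← hsph] at hw
    exact hfin (-w) (Submodule.neg_mem _ (chainsOf_mono Set.inter_subset_left _ hw))
      (Submodule.neg_mem _ (chainsOf_mono Set.inter_subset_right _ hw)) (by simp [hwz])

/-- Cycles can be pushed off a finite family of faces no two of which lie in a common simplex. -/
lemma push_off_faces {K : Set (Finset X)} (hK : DownClosed K) {m : ℕ} (𝓑 : Finset (Finset X))
    (hne : ∀ B ∈ 𝓑, B.Nonempty)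
    (huniq : ∀ σ ∈ K, ∀ B ∈ 𝓑, ∀ B' ∈ 𝓑, B ⊆ σ → B' ⊆ σ → B = B')
    (hfill : ∀ B ∈ 𝓑, ∀ m', m = m' + 1 → Fills F (sphereAround K B) m') {z : Chain F X}
    (hz : z ∈ chainsOf F K m) (hbd : bd z = 0) :
    ∃ z' ∈ chainsOf F (avoiding K 𝓑) m, ∃ w ∈ chainsOf F K (m + 1), z = z' + bd w := by
  induction 𝓑 using Finset.induction_on with
  | empty => exact ⟨z, by simpa [avoiding] using hz, 0, Submodule.zero_mem _, by simp⟩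
  | insert B 𝓑 hB ih =>
    obtain ⟨z', hz', w, hw, rfl⟩ := ih (fun B h => hne B (Finset.mem_insert_of_mem h))
      (fun σ hσ C hC C' hC' => huniq σ hσ C (Finset.mem_insert_of_mem hC) C'
        (Finset.mem_insert_of_mem hC')) (fun B h => hfill B (Finset.mem_insert_of_mem h))
    have hav : DownClosed (avoiding K (𝓑 : Set (Finset X))) := fun σ τ h hσ =>
      ⟨hK h hσ.1, fun C hC hCτ => hσ.2 C hC (hCτ.trans h)⟩
    have hsph : sphereAround (avoiding K (𝓑 : Set (Finset X))) B = sphereAround K B := by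
      ext σ
      simp only [sphereAround, avoiding, Set.mem_ofPred_eq]
      refine ⟨fun h => ⟨h.1.1, h.2⟩, fun h => ⟨⟨h.1, fun C hC hCσ => hB ?_⟩, h.2⟩⟩
      rw [huniq _ h.1 B (Finset.mem_insert_self _ _) C (Finset.mem_insert_of_mem hC)
        Finset.subset_union_right hCσ]
      exact hC
    obtain ⟨z'', hz'', w', hw', rfl⟩ := push_off_face hav (hne B (Finset.mem_insert_self _ _))
      (by rw [hsph]; exact hfill B (Finset.mem_insert_self _ _)) hz' (by simpa using hbd)
    refine ⟨z'', ?_, w' + w, Submodule.add_mem _ (chainsOf_mono (fun σ h => h.1) _ hw') hw, ?_⟩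
    · refine chainsOf_mono ?_ _ hz''
      refine fun σ hσ => ⟨hσ.1.1, fun C hC => ?_⟩
      rcases Finset.mem_insert.1 (Finset.mem_coe.1 hC) with rfl | hC
      · exact hσ.2 _ rfl
      · exact hσ.1.2 C hC
    · rw [map_add]; abel

/-- The multiple chessboard complex: partial placements of the rows in `A` into columns, where a row
may only be placed into a column of the same color and the column `t` receives at most `c t` rows. -/
def chessboard {R T : Type*} [DecidableEq T] (A : Finset R) (κ : R → ℕ) (τ c : T → ℕ) :
    Set (Finset (R × T)) :=
  {σ | (∀ v ∈ σ, v.1 ∈ A ∧ κ v.1 = τ v.2) ∧ (∀ v ∈ σ, ∀ w ∈ σ, v.1 = w.1 → v = w) ∧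
    ∀ t, (σ.filter (·.2 = t)).card ≤ c t}

section Chessboard

variable {R T : Type*} [DecidableEq T] {A : Finset R} {κ : R → ℕ} {τ c : T → ℕ}

lemma downClosed_chessboard : DownClosed (chessboard A κ τ c) := fun _ _ h hσ =>
  ⟨fun v hv => hσ.1 v (h hv), fun v hv w hw => hσ.2.1 v (h hv) w (h hw),
    fun t => (Finset.card_le_card (Finset.filter_subset_filter _ h)).trans (hσ.2.2 t)⟩

variable [DecidableEq R]

lemma insert_mem_chessboard {σ : Finset (R × T)} {x : R} {t : T} (hx : x ∈ A) (hxt : κ x = τ t)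
    (hc : 0 < c t) (hσ : σ ∈ chessboard (A.erase x) κ τ (Function.update c t (c t - 1))) :
    insert (x, t) σ ∈ chessboard A κ τ c := by
  obtain ⟨h1, h2, h3⟩ := hσ
  refine ⟨?_, ?_, fun t' => ?_⟩
  · intro v hv
    rcases Finset.mem_insert.1 hv with rfl | hv
    · exact ⟨hx, hxt⟩
    · exact ⟨Finset.mem_of_mem_erase (h1 v hv).1, (h1 v hv).2⟩
  · intro v hv w hw hvw
    rcases Finset.mem_insert.1 hv with rfl | hv <;> rcases Finset.mem_insert.1 hw with rfl | hw
    · rfl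
    · exact absurd hvw.symm (Finset.ne_of_mem_erase (h1 w hw).1)
    · exact absurd hvw (Finset.ne_of_mem_erase (h1 v hv).1)
    · exact h2 v hv w hw hvw
  · have := h3 t'
    rw [Finset.filter_insert]
    by_cases h : t' = t
    · subst h
      simp only [Function.update_self] at this
      simp only [if_true]
      have := Finset.card_insert_le (x, t') (σ.filter (·.2 = t'))
      omega
    · rw [if_neg (fun e => h e.symm)]
      simpa [Function.update_of_ne h] using this

lemma sphereAround_vertex {x : R} {t : T} (hx : x ∈ A) (hxt : κ x = τ t) (hc : 0 < c t) :
    sphereAround (chessboard A κ τ c) {(x, t)} =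
      chessboard (A.erase x) κ τ (Function.update c t (c t - 1)) := by
  ext σ
  have hu : σ ∪ {(x, t)} = insert (x, t) σ := by
    rw [Finset.union_comm, Finset.insert_eq]
  simp only [sphereAround, Set.mem_ofPred_eq, Finset.singleton_subset_iff, hu]
  constructor
  · rintro ⟨⟨h1, h2, h3⟩, hnot⟩
    refine ⟨fun v hv => ?_, fun v hv w hw => h2 v (Finset.mem_insert_of_mem hv) w
      (Finset.mem_insert_of_mem hw), fun t' => ?_⟩
    · have := h1 v (Finset.mem_insert_of_mem hv)
      refine ⟨Finset.mem_erase.2 ⟨fun e => hnot ?_, this.1⟩, this.2⟩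
      rw [← h2 v (Finset.mem_insert_of_mem hv) (x, t) (Finset.mem_insert_self _ _) e]
      exact hv
    · have := h3 t'
      rw [Finset.filter_insert] at this
      by_cases h : t' = t
      · subst h
        simp only [if_true] at this
        rw [Finset.card_insert_of_notMem (by simp [hnot])] at this
        simp only [Function.update_self]
        omega
      · rw [if_neg (fun e => h e.symm)] at this
        simpa [Function.update_of_ne h] using this
  · intro h
    exact ⟨insert_mem_chessboard hx hxt hc h,
      fun hm => by simpa using (h.1 _ hm).1⟩

lemma sphereAround_column {t₁ : T} (hc : 0 < c t₁) {S : Finset R} (hSA : S ⊆ A)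
    (hSκ : ∀ y ∈ S, κ y = τ t₁) (hS : S.card = c t₁) {j : ℕ} (hjA : ∀ y ∈ A, κ y ≠ j)
    (hjτ : ∀ t, τ t ≠ j) :
    sphereAround (chessboard A κ τ c) (S ×ˢ {t₁}) =
      chessboard A (fun y => if y ∈ S then j else κ y) (Function.update τ t₁ j)
        (Function.update c t₁ (c t₁ - 1)) := by
  have hmem : ∀ v : R × T, v ∈ S ×ˢ ({t₁} : Finset T) ↔ v.1 ∈ S ∧ v.2 = t₁ := by
    intro v
    rw [Finset.mem_product, Finset.mem_singleton]
  have hBcard : (S ×ˢ ({t₁} : Finset T)).card = c t₁ := by simp [hS]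
  ext σ
  simp only [sphereAround, Set.mem_ofPred_eq]
  constructor
  · rintro ⟨⟨h1, h2, h3⟩, hnot⟩
    have hfil : (σ ∪ S ×ˢ {t₁}).filter (·.2 = t₁) = S ×ˢ {t₁} := by
      refine (Finset.eq_of_subset_of_card_le ?_ ((h3 t₁).trans hBcard.ge)).symm
      intro v hv
      exact Finset.mem_filter.2 ⟨Finset.mem_union_right _ hv, ((hmem v).1 hv).2⟩
    have hcol : ∀ v ∈ σ, v.2 = t₁ → v ∈ S ×ˢ ({t₁} : Finset T) := fun v hv hvt => by
      rw [← hfil]; exact Finset.mem_filter.2 ⟨Finset.mem_union_left _ hv, hvt⟩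
    refine ⟨fun v hv => ?_, fun v hv w hw => h2 v (Finset.mem_union_left _ hv) w
      (Finset.mem_union_left _ hw), fun t => ?_⟩
    · have hv' := h1 v (Finset.mem_union_left _ hv)
      refine ⟨hv'.1, ?_⟩
      by_cases hvt : v.2 = t₁
      · simp [hvt, ((hmem v).1 (hcol v hv hvt)).1]
      · have : v.1 ∉ S := fun hvS => hvt <| congrArg Prod.snd <|
          h2 v (Finset.mem_union_left _ hv) (v.1, t₁)
            (Finset.mem_union_right _ ((hmem _).2 ⟨hvS, rfl⟩)) rfl
        simp [this, Function.update_of_ne hvt, hv'.2]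
    · by_cases ht : t = t₁
      · subst ht
        have hss : σ.filter (·.2 = t) ⊂ S ×ˢ {t} := by
          refine Finset.ssubset_iff_subset_ne.2 ⟨fun v hv => ?_, fun e => hnot ?_⟩
          · exact hcol v (Finset.mem_filter.1 hv).1 (Finset.mem_filter.1 hv).2
          · rw [← e]; exact Finset.filter_subset _ _
        have := Finset.card_lt_card hss
        simp only [Function.update_self]
        omega
      · rw [Function.update_of_ne ht]
        exact (Finset.card_le_card (Finset.filter_subset_filter _ Finset.subset_union_left)).trans
          (h3 t)
  · rintro ⟨h1, h2, h3⟩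
    have hin : ∀ v ∈ σ, v.2 = t₁ → v.1 ∈ S := fun v hv hvt => by
      by_contra hvS
      have := h1 v hv
      simp only [hvS, if_false, hvt, Function.update_self] at this
      exact hjA _ this.1 this.2
    have hout : ∀ v ∈ σ, v.2 ≠ t₁ → v.1 ∉ S := fun v hv hvt hvS => by
      have := h1 v hv
      simp only [hvS, if_true, Function.update_of_ne hvt] at this
      exact hjτ _ this.2.symm
    refine ⟨⟨fun v hv => ?_, fun v hv w hw hvw => ?_, fun t => ?_⟩, fun hsub => ?_⟩
    · rcases Finset.mem_union.1 hv with hv | hv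
      · refine ⟨(h1 v hv).1, ?_⟩
        by_cases hvt : v.2 = t₁
        · rw [hvt]; exact hSκ _ (hin v hv hvt)
        · simpa [hout v hv hvt, Function.update_of_ne hvt] using (h1 v hv).2
      · rw [hmem] at hv
        exact ⟨hSA hv.1, by rw [hv.2]; exact hSκ _ hv.1⟩
    · rcases Finset.mem_union.1 hv with hv | hv <;> rcases Finset.mem_union.1 hw with hw | hw
      · exact h2 v hv w hw hvw
      · rw [hmem] at hw
        have : v.2 = t₁ := by
          by_contra h; exact hout v hv h (hvw ▸ hw.1)
        exact Prod.ext hvw (this.trans hw.2.symm)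
      · rw [hmem] at hv
        have : w.2 = t₁ := by
          by_contra h; exact hout w hw h (hvw ▸ hv.1)
        exact Prod.ext hvw (hv.2.trans this.symm)
      · rw [hmem] at hv hw
        exact Prod.ext hvw (hv.2.trans hw.2.symm)
    · by_cases ht : t = t₁
      · subst ht
        refine (Finset.card_le_card ?_).trans hBcard.le
        intro v hv
        obtain ⟨hv, hvt⟩ := Finset.mem_filter.1 hv
        rcases Finset.mem_union.1 hv with hv | hv
        · exact (hmem v).2 ⟨hin v hv hvt, hvt⟩
        · exact hv
      · have := h3 t
        rw [Function.update_of_ne ht] at this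
        refine (Finset.card_le_card fun v hv => ?_).trans this
        obtain ⟨hv, hvt⟩ := Finset.mem_filter.1 hv
        refine Finset.mem_filter.2 ⟨?_, hvt⟩
        rcases Finset.mem_union.1 hv with hv | hv
        · exact hv
        · exact absurd (hvt.symm.trans ((hmem v).1 hv).2) ht
    · have := h3 t₁
      simp only [Function.update_self] at this
      have hle : (S ×ˢ ({t₁} : Finset T)).card ≤ (σ.filter (·.2 = t₁)).card :=
        Finset.card_le_card fun v hv => Finset.mem_filter.2 ⟨hsub hv, ((hmem v).1 hv).2⟩
      omega

/-- The number of rows that a column of capacity `c` requires for the chessboard complex to be as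
highly connected as its total capacity allows; an unused column requires none. -/
def demand (c : ℕ) : ℕ := if c = 0 then 0 else c + 1

lemma demand_pred_lt {c : ℕ} (hc : 0 < c) : demand (c - 1) + 1 ≤ demand c := by
  unfold demand; split_ifs <;> omega

variable [Fintype T]

lemma sum_demand_update {t₁ : T} (hc : 0 < c t₁) (i : ℕ) :
    ∑ t with τ t = i, demand (Function.update c t₁ (c t₁ - 1) t) + (if τ t₁ = i then 1 else 0) ≤
      ∑ t with τ t = i, demand (c t) := by
  have hle : ∀ t, demand (Function.update c t₁ (c t₁ - 1) t) + (if t = t₁ then 1 else 0)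
      ≤ demand (c t) := by
    intro t
    by_cases h : t = t₁
    · subst h; simpa using demand_pred_lt hc
    · simp [h]
  refine le_trans (le_of_eq ?_) (Finset.sum_le_sum fun t _ => hle t)
  rw [Finset.sum_add_distrib, Finset.sum_ite_eq']
  simp

/-- Multiple chessboard complexes with enough rows are acyclic below their top dimension. -/
theorem fills_chessboard (F : Type*) [CommRing F] (n : ℕ) :
    ∀ (A : Finset R) (κ : R → ℕ) (τ c : T → ℕ), A.card = n →
    (∀ i, ∑ t with τ t = i, demand (c t) ≤ (A.filter (κ · = i)).card + 1) →
    ∀ m < ∑ t, c t, Fills F (chessboard A κ τ c) m := by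
  induction n with
  | zero =>
    intro A κ τ c hA hrows m hm
    exfalso
    obtain ⟨t₁, -, ht₁⟩ := Finset.exists_ne_zero_of_sum_ne_zero (by omega : ∑ t, c t ≠ 0)
    have h := hrows (τ t₁)
    have h' : c t₁ + 1 ≤ ∑ t with τ t = τ t₁, demand (c t) := by
      refine le_trans ?_ (Finset.single_le_sum (f := fun t => demand (c t)) (a := t₁)
        (fun _ _ => Nat.zero_le _) (by simp))
      simp [demand, ht₁]
    rw [Finset.card_eq_zero.1 hA] at h
    simp only [Finset.filter_empty, Finset.card_empty] at h
    omega
  | succ n ih =>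
    intro A κ τ c hA hrows m hm z hz hbd
    obtain ⟨t₁, -, ht₁⟩ := Finset.exists_ne_zero_of_sum_ne_zero (by omega : ∑ t, c t ≠ 0)
    have ht₁ : 0 < c t₁ := Nat.pos_of_ne_zero ht₁
    have hsum : ∀ t, 0 < c t →
        ∑ t', Function.update c t (c t - 1) t' + 1 = ∑ t', c t' := by
      intro t ht
      rw [Finset.sum_update_of_mem (Finset.mem_univ _), ← Finset.add_sum_erase _ c
        (Finset.mem_univ t), Finset.sdiff_singleton_eq_erase]
      omega
    have h' : c t₁ + 1 ≤ ∑ t with τ t = τ t₁, demand (c t) := by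
      refine le_trans ?_ (Finset.single_le_sum (f := fun t => demand (c t)) (a := t₁)
        (fun _ _ => Nat.zero_le _) (by simp))
      simp [demand, ht₁.ne']
    have hpos : 0 < (A.filter (κ · = τ t₁)).card := by
      have := hrows (τ t₁)
      omega
    obtain ⟨x, hx⟩ := Finset.card_pos.1 hpos
    obtain ⟨hxA, hxκ⟩ := Finset.mem_filter.1 hx
    have hcardA : (A.erase x).card = n := by rw [Finset.card_erase_of_mem hxA]; omega
    have hfe : ∀ i, ((A.erase x).filter (κ · = i)).card + (if κ x = i then 1 else 0) =
        (A.filter (κ · = i)).card := by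
      intro i
      rw [Finset.filter_erase]
      split_ifs with h
      · exact Finset.card_erase_add_one (Finset.mem_filter.2 ⟨hxA, h⟩)
      · rw [Finset.erase_eq_of_notMem (by simp [h])]
        rfl
    -- Push the cycle off the vertices in the row `x`.
    let 𝓑₁ : Finset (Finset (R × T)) :=
      (Finset.univ.filter fun t => κ x = τ t ∧ 0 < c t).image fun t => {(x, t)}
    obtain ⟨z₁, hz₁, w₁, hw₁, rfl⟩ := push_off_faces (F := F) downClosed_chessboard 𝓑₁
      (by
        intro B hB
        simp only [𝓑₁, Finset.mem_image] at hB
        obtain ⟨t, -, rfl⟩ := hB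
        exact Finset.singleton_nonempty _)
      (by
        intro σ hσ B hB B' hB' hs hs'
        simp only [𝓑₁, Finset.mem_image] at hB hB'
        obtain ⟨t, -, rfl⟩ := hB
        obtain ⟨t', -, rfl⟩ := hB'
        rw [hσ.2.1 _ (Finset.singleton_subset_iff.1 hs) _ (Finset.singleton_subset_iff.1 hs') rfl])
      (by
        intro B hB m' hm'
        simp only [𝓑₁, Finset.mem_image, Finset.mem_filter, Finset.mem_univ, true_and] at hB
        obtain ⟨t, ⟨hxt, ht⟩, rfl⟩ := hB
        rw [sphereAround_vertex hxA hxt ht]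
        refine ih _ _ _ _ hcardA (fun i => ?_) m' (by have := hsum t ht; omega)
        have h1 := sum_demand_update (τ := τ) ht i
        have h2 := hfe i
        have h3 := hrows i
        rw [hxt] at h2
        omega) hz hbd
    have hav₁ : avoiding (chessboard A κ τ c) (𝓑₁ : Set (Finset (R × T))) ⊆
        chessboard (A.erase x) κ τ c := by
      rintro σ ⟨hσ, hσB⟩
      refine ⟨fun v hv => ⟨Finset.mem_erase.2 ⟨?_, (hσ.1 v hv).1⟩, (hσ.1 v hv).2⟩, hσ.2⟩
      rintro rfl
      refine hσB {v} ?_ (by simpa using hv)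
      simp only [𝓑₁, Finset.coe_image, Set.mem_image, Finset.coe_filter, Finset.mem_univ, true_and]
      refine ⟨v.2, ⟨(hσ.1 v hv).2, ?_⟩, rfl⟩
      exact lt_of_lt_of_le (Finset.card_pos.2 ⟨v, by simp [hv]⟩) (hσ.2.2 v.2)
    have hmono : chessboard (A.erase x) κ τ c ⊆ chessboard A κ τ c := fun σ hσ =>
      ⟨fun v hv => ⟨Finset.mem_of_mem_erase (hσ.1 v hv).1, (hσ.1 v hv).2⟩, hσ.2⟩
    -- Push it off the simplices that fill the column `t₁`.
    let 𝓑₂ : Finset (Finset (R × T)) :=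
      (((A.erase x).filter (κ · = τ t₁)).powersetCard (c t₁)).image fun S => S ×ˢ {t₁}
    obtain ⟨j, hj⟩ := Infinite.exists_notMem_finset (A.image κ ∪ Finset.univ.image τ)
    simp only [Finset.mem_union, Finset.mem_image, Finset.mem_univ, true_and, not_or,
      not_exists, not_and] at hj
    obtain ⟨z₂, hz₂, w₂, hw₂, rfl⟩ := push_off_faces (F := F) downClosed_chessboard 𝓑₂
      (by
        intro B hB
        simp only [𝓑₂, Finset.mem_image, Finset.mem_powersetCard] at hB
        obtain ⟨S, hS, rfl⟩ := hB
        refine Finset.Nonempty.product (Finset.card_pos.1 (by omega)) (Finset.singleton_nonempty _))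
      (by
        intro σ hσ B hB B' hB' hs hs'
        have key : ∀ B ∈ 𝓑₂, B ⊆ σ → B = σ.filter (·.2 = t₁) := by
          intro B hB hs
          simp only [𝓑₂, Finset.mem_image, Finset.mem_powersetCard] at hB
          obtain ⟨S, hS, rfl⟩ := hB
          refine Finset.eq_of_subset_of_card_le (fun v hv => Finset.mem_filter.2 ⟨hs hv, ?_⟩) ?_
          · simpa using (Finset.mem_product.1 hv).2
          · refine (hσ.2.2 t₁).trans ?_
            simp [hS.2]
        rw [key B hB hs, key B' hB' hs'])
      (by
        intro B hB m' hm'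
        simp only [𝓑₂, Finset.mem_image, Finset.mem_powersetCard] at hB
        obtain ⟨S, ⟨hS, hScard⟩, rfl⟩ := hB
        have hSA : S ⊆ A.erase x := hS.trans (Finset.filter_subset _ _)
        have hSκ : ∀ y ∈ S, κ y = τ t₁ := fun y hy => (Finset.mem_filter.1 (hS hy)).2
        rw [sphereAround_column ht₁ hSA hSκ hScard
          (j := j) (fun y hy => hj.1 y (Finset.mem_of_mem_erase hy)) hj.2]
        refine ih _ _ _ _ hcardA (fun i => ?_) m' (by have := hsum t₁ ht₁; omega)
        by_cases hij : i = j
        · subst hij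
          have e1 : (Finset.univ.filter fun t => Function.update τ t₁ i t = i) = {t₁} := by
            ext t
            by_cases h : t = t₁
            · simp [h]
            · simp [h, hj.2 t]
          have e2 : (A.erase x).filter (fun y => (if y ∈ S then i else κ y) = i) = S := by
            ext y
            by_cases h : y ∈ S
            · simp [h, hSA h]
            · simp only [h, if_false, Finset.mem_filter, iff_false, not_and]
              exact fun hy => hj.1 y (Finset.mem_of_mem_erase hy)
          rw [e1, e2, hScard]
          simp only [Finset.sum_singleton, Function.update_self, demand]
          split_ifs <;> omega
        · have e1 : ∑ t with Function.update τ t₁ j t = i,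
              demand (Function.update c t₁ (c t₁ - 1) t) +
                (if τ t₁ = i then demand (c t₁) else 0) = ∑ t with τ t = i, demand (c t) := by
            have : (Finset.univ.filter fun t => Function.update τ t₁ j t = i) =
                (Finset.univ.filter fun t => τ t = i).erase t₁ := by
              ext t
              by_cases h : t = t₁
              · simp [h, Ne.symm hij]
              · simp [h]
            rw [this, Finset.sum_congr rfl (g := fun t => demand (c t)) (fun t ht => by
              rw [Function.update_of_ne (Finset.ne_of_mem_erase ht)])]
            split_ifs with h
            · exact Finset.sum_erase_add _ _ (by simp [h])
            · rw [Finset.erase_eq_of_notMem (by simp [h])]; rfl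
          have e2 : ((A.erase x).filter (fun y => (if y ∈ S then j else κ y) = i)).card +
              (if τ t₁ = i then c t₁ else 0) = ((A.erase x).filter (κ · = i)).card := by
            have : (A.erase x).filter (fun y => (if y ∈ S then j else κ y) = i) =
                (A.erase x).filter (κ · = i) \ S := by
              ext y
              by_cases h : y ∈ S
              · simp [h, Ne.symm hij]
              · simp [h]
            rw [this]
            split_ifs with h
            · rw [Finset.card_sdiff_of_subset (by rw [← h]; exact hS), hScard]
              have := Finset.card_le_card hS
              rw [hScard, h] at this
              omega
            · rw [Finset.sdiff_eq_self_of_disjoint]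
              · rfl
              · rw [Finset.disjoint_left]
                intro y hy hyS
                exact h ((hSκ y hyS).symm.trans (Finset.mem_filter.1 hy).2)
          have h2 := hfe i
          have h3 := hrows i
          rw [hxκ] at h2
          simp only [demand, ht₁.ne', if_false] at e1 h3 ⊢
          split_ifs at e1 e2 h2 <;> omega)
      (chainsOf_mono hav₁ _ hz₁) (by simpa using hbd)
    -- What remains is coned off from the vertex `(x, t₁)`.
    refine ⟨cone (x, t₁) z₂ + w₂ + w₁, Submodule.add_mem _ (Submodule.add_mem _ ?_ ?_) hw₁, ?_⟩
    · refine cone_mem_chainsOf hz₂ fun σ hσ => insert_mem_chessboard hxA hxκ ht₁ ?_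
      refine ⟨hσ.1.1, hσ.1.2.1, fun t => ?_⟩
      by_cases h : t = t₁
      · subst h
        rw [Function.update_self]
        by_contra hlt
        have hle := hσ.1.2.2 t
        have hcol : ((σ.filter (·.2 = t)).image Prod.fst).card = c t := by
          rw [Finset.card_image_of_injOn]
          · omega
          · intro v hv w hw hvw
            exact hσ.1.2.1 v (Finset.mem_filter.1 hv).1 w (Finset.mem_filter.1 hw).1 hvw
        refine hσ.2 (((σ.filter (·.2 = t)).image Prod.fst) ×ˢ {t}) ?_ ?_
        · simp only [𝓑₂, Finset.coe_image, Set.mem_image, Finset.mem_coe, Finset.mem_powersetCard]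
          refine ⟨_, ⟨fun y hy => ?_, hcol⟩, rfl⟩
          obtain ⟨v, hv, rfl⟩ := Finset.mem_image.1 hy
          obtain ⟨hv, hvt⟩ := Finset.mem_filter.1 hv
          exact Finset.mem_filter.2 ⟨(hσ.1.1 v hv).1, by rw [(hσ.1.1 v hv).2, hvt]⟩
        · intro v hv
          obtain ⟨hv1, hv2⟩ := Finset.mem_product.1 hv
          obtain ⟨w, hw, hwv⟩ := Finset.mem_image.1 hv1
          obtain ⟨hw, hwt⟩ := Finset.mem_filter.1 hw
          rwa [show v = w from Prod.ext hwv.symm (by simp_all)]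
      · rw [Function.update_of_ne h]
        exact hσ.1.2.2 t
    · exact chainsOf_mono hmono _ hw₂
    · have : bd z₂ = 0 := by simpa using hbd
      rw [map_add, map_add, bd_cone, this]
      simp

end Chessboard

section Resolution

lemma degree_sub_single {ι : Type*} {a : ι →₀ ℕ} {i : ι} (h : i ∈ a.support) :
    (a - Finsupp.single i 1).degree + 1 = a.degree := by
  have h1 : Finsupp.single i 1 ≤ a := by
    rw [Finsupp.single_le_iff]; exact Nat.one_le_iff_ne_zero.2 (Finsupp.mem_support_iff.1 h)
  conv_rhs => rw [← tsub_add_cancel_of_le h1, map_add]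
  simp

variable {ι : Type*} [Fintype ι] [LinearOrder ι]

/-- The Koszul sign of the `i`-th partial differential at the multidegree `a`. -/
def koszulSign (F : Type*) [CommRing F] (i : ι) (a : ι →₀ ℕ) : F :=
  (-1) ^ ∑ l with l < i, a l

lemma koszulSign_mul_add (F : Type*) [CommRing F] {a : ι →₀ ℕ} {i l : ι} (hi : i ∈ a.support)
    (hl : l ∈ a.support) (hil : i ≠ l) :
    koszulSign F i a * koszulSign F l (a - Finsupp.single i 1) +
      koszulSign F l a * koszulSign F i (a - Finsupp.single l 1) = 0 := by
  wlog h : i < l generalizing i l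
  · rw [add_comm]
    exact this hl hi hil.symm (lt_of_le_of_ne (not_lt.1 h) hil.symm)
  have h1 : koszulSign F i (a - Finsupp.single l 1) = koszulSign F i a := by
    unfold koszulSign
    congr 1
    refine Finset.sum_congr rfl fun k hk => ?_
    have : l ≠ k := ((Finset.mem_filter.1 hk).2.trans h).ne'
    simp [this.symm]
  have h2 : koszulSign F l a = - koszulSign F l (a - Finsupp.single i 1) := by
    unfold koszulSign
    have : ∑ k with k < l, a k = ∑ k with k < l, (a - Finsupp.single i 1 : ι →₀ ℕ) k + 1 := by
      rw [← Finset.add_sum_erase _ _ (show i ∈ Finset.univ.filter (· < l) by simpa using h),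
        ← Finset.add_sum_erase _ (fun k => (a - Finsupp.single i 1 : ι →₀ ℕ) k)
          (show i ∈ Finset.univ.filter (· < l) by simpa using h)]
      rw [Finset.sum_congr rfl (g := fun k => (a - Finsupp.single i 1 : ι →₀ ℕ) k) (fun k hk => by
        simp [Finset.ne_of_mem_erase hk])]
      have : a i ≠ 0 := Finsupp.mem_support_iff.1 hi
      simp only [Finsupp.coe_tsub, Pi.sub_apply, Finsupp.single_eq_same]
      omega
    rw [this, pow_succ]
    ring
  rw [h1, h2]
  ring

/-- In a complex that is acyclic up to level `N`, a family of commuting periodic operators can be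
resolved: this is the comparison map from a tensor product of periodic resolutions. -/
theorem exists_resolution {F M : Type*} [CommRing F] [AddCommGroup M] [Module F M]
    (C : ℕ → Submodule F M) (d : M →ₗ[F] M) (D : ι → ℕ → M →ₗ[F] M)
    (hDd : ∀ i b z, d (D i b z) = D i b (d z))
    (hcomm : ∀ i b l b', ∀ z, D i b (D l b' z) = D l b' (D i b z))
    (hDD : ∀ i b z, D i (b + 1) (D i b z) = 0)
    (hC : ∀ i b n, ∀ z ∈ C n, D i b z ∈ C n) (N : ℕ)
    (hfill : ∀ m ≤ N, ∀ z ∈ C m, d z = 0 → ∃ w ∈ C (m + 1), d w = z)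
    (h₀ : M) (hh₀ : h₀ ∈ C 1) (hDh₀ : ∀ i, D i 1 (d h₀) = 0) :
    ∃ h : (ι →₀ ℕ) → M, h 0 = h₀ ∧ ∀ a : ι →₀ ℕ, a.degree ≤ N → h a ∈ C (a.degree + 1) ∧
      (a ≠ 0 → d (h a) =
        ∑ i ∈ a.support, koszulSign F i a • D i (a i) (h (a - Finsupp.single i 1))) := by
  suffices H : ∀ n ≤ N, ∃ h : (ι →₀ ℕ) → M, h 0 = h₀ ∧
      ∀ a : ι →₀ ℕ, a.degree ≤ n → h a ∈ C (a.degree + 1) ∧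
      (a ≠ 0 → d (h a) =
        ∑ i ∈ a.support, koszulSign F i a • D i (a i) (h (a - Finsupp.single i 1))) from
    H N le_rfl
  intro n
  induction n with
  | zero =>
    intro _
    refine ⟨fun _ => h₀, rfl, fun a ha => ?_⟩
    obtain rfl : a = 0 := (Finsupp.degree_eq_zero_iff a).1 (Nat.le_zero.1 ha)
    exact ⟨by simpa using hh₀, fun h => absurd rfl h⟩
  | succ n ih =>
    intro hn
    obtain ⟨h, h0, hh⟩ := ih (by omega)
    have key : ∀ a : ι →₀ ℕ, a.degree = n + 1 → ∃ w ∈ C (n + 1 + 1), d w =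
        ∑ i ∈ a.support, koszulSign F i a • D i (a i) (h (a - Finsupp.single i 1)) := by
      intro a ha
      have hdeg : ∀ i ∈ a.support, (a - Finsupp.single i 1).degree = n := fun i hi => by
        have := degree_sub_single hi
        omega
      refine hfill (n + 1) hn _ (Submodule.sum_mem _ fun i hi => Submodule.smul_mem _ _ ?_) ?_
      · refine hC _ _ _ _ ?_
        have := (hh _ (hdeg i hi).le).1
        rwa [hdeg i hi] at this
      · rcases n with _ | n
        · rw [map_sum]
          refine Finset.sum_eq_zero fun i hi => ?_
          have e : a - Finsupp.single i 1 = 0 := (Finsupp.degree_eq_zero_iff _).1 (hdeg i hi)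
          have e' : a i = 1 := by
            have h1 := DFunLike.congr_fun e i
            have h2 := Finsupp.mem_support_iff.1 hi
            simp at h1
            omega
          rw [map_smul, hDd, e, h0, e', hDh₀, smul_zero]
        · have e : d (∑ i ∈ a.support, koszulSign F i a •
                D i (a i) (h (a - Finsupp.single i 1))) =
              ∑ i ∈ a.support, ∑ l ∈ (a - Finsupp.single i 1).support,
                (koszulSign F i a * koszulSign F l (a - Finsupp.single i 1)) •
                  D i (a i) (D l ((a - Finsupp.single i 1 : ι →₀ ℕ) l)
                    (h (a - Finsupp.single i 1 - Finsupp.single l 1))) := by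
            rw [map_sum]
            refine Finset.sum_congr rfl fun i hi => ?_
            rw [map_smul, hDd, (hh _ (hdeg i hi).le).2 ?_, map_sum, Finset.smul_sum]
            · exact Finset.sum_congr rfl fun l _ => by rw [map_smul, smul_smul]
            · intro e
              have := hdeg i hi
              rw [e] at this
              simp at this
          rw [e, Finset.sum_sigma']
          have hne : ∀ i l : ι, i ≠ l → (a - Finsupp.single i 1 : ι →₀ ℕ) l = a l :=
            fun i l hil => by simp [hil.symm]
          have hmem : ∀ i l : ι, i ∈ a.support → l ∈ (a - Finsupp.single i 1).support →
              l ∈ a.support := fun i l _ hl => by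
            rw [Finsupp.mem_support_iff] at hl ⊢
            intro h
            simp [h] at hl
          refine Finset.sum_involution (fun x _ => ⟨x.2, x.1⟩) ?_ ?_ ?_ ?_
          · rintro ⟨i, l⟩ hx
            obtain ⟨hi, hl⟩ := Finset.mem_sigma.1 hx
            simp only at hi hl ⊢
            by_cases hil : i = l
            · subst hil
              have : a i = (a - Finsupp.single i 1 : ι →₀ ℕ) i + 1 := by
                have := Finsupp.mem_support_iff.1 hi
                simp only [Finsupp.coe_tsub, Pi.sub_apply, Finsupp.single_eq_same]
                omega
              rw [this, hDD]
              simp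
            · rw [hne i l hil, hne l i (Ne.symm hil), hcomm l, tsub_right_comm, ← add_smul,
                koszulSign_mul_add F hi (hmem i l hi hl) hil, zero_smul]
          · rintro ⟨i, l⟩ hx hf heq
            obtain ⟨hi, hl⟩ := Finset.mem_sigma.1 hx
            simp only [Sigma.mk.injEq, heq_eq_eq] at heq
            obtain ⟨rfl, -⟩ := heq
            apply hf
            simp only at hi hl ⊢
            have : a l = (a - Finsupp.single l 1 : ι →₀ ℕ) l + 1 := by
              have := Finsupp.mem_support_iff.1 hi
              simp only [Finsupp.coe_tsub, Pi.sub_apply, Finsupp.single_eq_same]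
              omega
            rw [this, hDD]
            simp
          · rintro ⟨i, l⟩ hx
            obtain ⟨hi, hl⟩ := Finset.mem_sigma.1 hx
            simp only at hi hl
            rw [Finset.mem_sigma]
            refine ⟨hmem i l hi hl, ?_⟩
            simp only
            by_cases hil : i = l
            · subst hil; exact hl
            · rw [Finsupp.mem_support_iff, hne l i (Ne.symm hil)]
              exact Finsupp.mem_support_iff.1 hi
          · rintro ⟨i, l⟩ hx
            rfl
    choose! w hwC hwd using key
    refine ⟨fun a => if a.degree ≤ n then h a else w a, by simp [h0], fun a ha => ?_⟩
    have hsub : ∀ i ∈ a.support, (a - Finsupp.single i 1).degree ≤ n := fun i hi => by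
      have := degree_sub_single hi
      omega
    have hsum : ∑ i ∈ a.support, koszulSign F i a • D i (a i)
          ((fun a : ι →₀ ℕ => if a.degree ≤ n then h a else w a) (a - Finsupp.single i 1)) =
        ∑ i ∈ a.support, koszulSign F i a • D i (a i) (h (a - Finsupp.single i 1)) :=
      Finset.sum_congr rfl fun i hi => by simp only [hsub i hi, if_true]
    rw [hsum]
    by_cases hle : a.degree ≤ n
    · simpa only [hle, if_true] using hh a hle
    · have hdeg : a.degree = n + 1 := by omega
      simp only [hle, if_false]
      exact ⟨hdeg ▸ hwC a hdeg, fun _ => hwd a hdeg⟩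

end Resolution

section Periodic

variable {F M N : Type*} [CommRing F] [AddCommGroup M] [Module F M] [AddCommGroup N] [Module F N]

/-- The operators of the periodic resolution of a cyclic group of order `p`: `U - 1` in odd degrees
and the norm `1 + U + ⋯ + U ^ (p - 1)` in even degrees. -/
def periodic (p : ℕ) (U : Module.End F M) (b : ℕ) : Module.End F M :=
  if Odd b then U - 1 else ∑ s ∈ Finset.range p, U ^ s

lemma periodic_of_odd {p : ℕ} {U : Module.End F M} {b : ℕ} (hb : Odd b) (z : M) :
    periodic p U b z = U z - z := by
  simp [periodic, hb]

lemma periodic_of_even {p : ℕ} {U : Module.End F M} {b : ℕ} (hb : Even b) (z : M) :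
    periodic p U b z = ∑ s ∈ Finset.range p, (U ^ s) z := by
  simp [periodic, Nat.not_odd_iff_even.2 hb, LinearMap.sum_apply]

lemma pow_intertwine {W : M →ₗ[F] N} {U : Module.End F M} {U' : Module.End F N}
    (h : ∀ z, W (U z) = U' (W z)) (s : ℕ) (z : M) : W ((U ^ s) z) = (U' ^ s) (W z) := by
  induction s with
  | zero => simp
  | succ s ih => rw [pow_succ', pow_succ', Module.End.mul_apply, Module.End.mul_apply, h, ih]

lemma periodic_intertwine {W : M →ₗ[F] N} {U : Module.End F M} {U' : Module.End F N}
    (h : ∀ z, W (U z) = U' (W z)) (p b : ℕ) (z : M) :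
    W (periodic p U b z) = periodic p U' b (W z) := by
  by_cases hb : Odd b
  · rw [periodic_of_odd hb, periodic_of_odd hb, map_sub, h]
  · rw [Nat.not_odd_iff_even] at hb
    rw [periodic_of_even hb, periodic_of_even hb, map_sum]
    exact Finset.sum_congr rfl fun s _ => pow_intertwine h s z

lemma periodic_comm {U U' : Module.End F M} (h : ∀ z, U (U' z) = U' (U z)) (p b b' : ℕ) (z : M) :
    periodic p U b (periodic p U' b' z) = periodic p U' b' (periodic p U b z) :=
  periodic_intertwine (fun z => (periodic_intertwine (fun z => (h z).symm) p b z).symm) p b' z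

lemma periodic_succ_periodic {p : ℕ} {U : Module.End F M} (h : U ^ p = 1) (b : ℕ) (z : M) :
    periodic p U (b + 1) (periodic p U b z) = 0 := by
  have h1 : (∑ s ∈ Finset.range p, U ^ s) * (U - 1) = 0 := by rw [geom_sum_mul, h, sub_self]
  have h2 : (U - 1) * ∑ s ∈ Finset.range p, U ^ s = 0 := by rw [mul_geom_sum, h, sub_self]
  rw [← Module.End.mul_apply]
  by_cases hb : Odd b
  · rw [periodic, periodic, if_pos hb, if_neg (by simpa [Nat.odd_add_one] using hb), h1]; rfl
  · rw [periodic, periodic, if_neg hb, if_pos (by simpa [Nat.odd_add_one] using hb), h2]; rfl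

end Periodic

section Subdivision

variable {F : Type*} [CommRing F] {X : Type*}

/-- Barycentric subdivision of chains of lists of length at most `n`, the barycenter of `x :: l`
being `b x l`. -/
noncomputable def subdivide (b : X → List X → X) : ℕ → Chain F X →ₗ[F] Chain F X
  | 0 => Finsupp.linearCombination F fun l => match l with
    | [] => Finsupp.single [] 1
    | _ :: _ => 0
  | n + 1 => Finsupp.linearCombination F fun l => match l with
    | [] => Finsupp.single [] 1
    | x :: l => cone (b x l) (subdivide b n (bd (Finsupp.single (x :: l) 1)))

variable {b : X → List X → X}

lemma subdivide_nil (n : ℕ) :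
    subdivide b n (Finsupp.single [] (1 : F)) = Finsupp.single [] 1 := by
  cases n <;> simp [subdivide]

lemma subdivide_zero_cons (x : X) (l : List X) :
    subdivide b 0 (Finsupp.single (x :: l) (1 : F)) = 0 := by
  simp [subdivide]

lemma subdivide_succ_cons (n : ℕ) (x : X) (l : List X) :
    subdivide b (n + 1) (Finsupp.single (x :: l) (1 : F)) =
      cone (b x l) (subdivide b n (bd (Finsupp.single (x :: l) 1))) := by
  simp [subdivide]

lemma bd_subdivide_zero (z : Chain F X) : bd (subdivide b 0 z) = 0 := by
  have : bd ∘ₗ subdivide b 0 = (0 : Chain F X →ₗ[F] Chain F X) :=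
    hom_ext fun l => by cases l <;> simp [subdivide_nil, subdivide_zero_cons]
  exact LinearMap.congr_fun this z

lemma bd_subdivide (n : ℕ) (z : Chain F X) :
    bd (subdivide b (n + 1) z) = subdivide b n (bd z) := by
  suffices bd ∘ₗ subdivide b (n + 1) = (subdivide b n ∘ₗ bd : Chain F X →ₗ[F] Chain F X) from
    LinearMap.congr_fun this z
  induction n with
  | zero =>
    refine hom_ext fun l => ?_
    cases l
    · simp [subdivide_nil]
    · simp [subdivide_succ_cons, bd_cone, bd_subdivide_zero]
  | succ n ih =>
    have ih' : ∀ z : Chain F X, bd (subdivide b (n + 1) z) = subdivide b n (bd z) :=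
      LinearMap.congr_fun ih
    refine hom_ext fun l => ?_
    cases l
    · simp [subdivide_nil]
    · simp [subdivide_succ_cons, bd_cone, ih']

lemma subdivide_map {f : X → X} (hf : ∀ x l, b (f x) (l.map f) = f (b x l)) (n : ℕ)
    (z : Chain F X) : subdivide b n (map f z) = map f (subdivide b n z) := by
  suffices subdivide b n ∘ₗ map f = (map f ∘ₗ subdivide b n : Chain F X →ₗ[F] Chain F X) from
    LinearMap.congr_fun this z
  induction n with
  | zero =>
    refine hom_ext fun l => ?_
    cases l <;> simp [subdivide_nil, subdivide_zero_cons]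
  | succ n ih =>
    have ih' : ∀ z : Chain F X, subdivide b n (map f z) = map f (subdivide b n z) :=
      LinearMap.congr_fun ih
    refine hom_ext fun l => ?_
    cases l with
    | nil => simp [subdivide_nil]
    | cons x l =>
      have : (Finsupp.single (f x :: l.map f) 1 : Chain F X) =
          map f (Finsupp.single (x :: l) 1) := by
        simp
      simp [subdivide_succ_cons, map_cone, hf]
      rw [this, bd_map, ih']

end Subdivision

section Barycenter

variable {F : Type*} [CommRing F] {V T : Type*} [NormedAddCommGroup V] [NormedSpace ℝ V]

/-- The barycenter of `x :: l`, carrying the tag of `x`. -/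
noncomputable def barycenter (x : V × T) (l : List (V × T)) : V × T :=
  (((l.length : ℝ) + 1)⁻¹ • ((x :: l).map Prod.fst).sum, x.2)

lemma dist_barycenter_le {x v : V × T} {l : List (V × T)} {δ : ℝ} {N : ℕ} (hδ : 0 ≤ δ)
    (hv : v ∈ x :: l) (hN : l.length ≤ N) (h : ∀ w ∈ x :: l, dist v.1 w.1 ≤ δ) :
    dist v.1 (barycenter x l).1 ≤ N / (N + 1) * δ := by
  have hpos : (0 : ℝ) < l.length + 1 := by positivity
  set m := (x :: l).erase v with hm
  have hperm := List.perm_cons_erase hv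
  have hlen : m.length = l.length := by rw [hm, List.length_erase_of_mem hv]; simp
  have hsum : ((x :: l).map Prod.fst).sum = v.1 + (m.map Prod.fst).sum := by
    rw [(hperm.map Prod.fst).sum_eq]; simp [hm]
  have key : ∀ m : List (V × T), (∀ w ∈ m, dist v.1 w.1 ≤ δ) →
      ‖(m.length : ℝ) • v.1 - (m.map Prod.fst).sum‖ ≤ m.length * δ := by
    intro m hm
    induction m with
    | nil => simp
    | cons w m ih =>
      have h1 := ih fun u hu => hm u (List.mem_cons_of_mem _ hu)
      have h2 := hm w List.mem_cons_self
      rw [dist_eq_norm] at h2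
      have : ((w :: m).length : ℝ) • v.1 - ((w :: m).map Prod.fst).sum =
          (v.1 - w.1) + ((m.length : ℝ) • v.1 - (m.map Prod.fst).sum) := by
        simp [add_smul]; abel
      rw [this]
      refine (norm_add_le _ _).trans ((add_le_add h2 h1).trans (le_of_eq ?_))
      push_cast [List.length_cons]; ring
  have h1 := key m fun w hw => h w (List.mem_of_mem_erase hw)
  rw [hlen] at h1
  have e : v.1 - (barycenter x l).1 =
      ((l.length : ℝ) + 1)⁻¹ • ((l.length : ℝ) • v.1 - (m.map Prod.fst).sum) := by
    rw [barycenter, hsum]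
    rw [eq_inv_smul_iff₀ hpos.ne', smul_sub, smul_inv_smul₀ hpos.ne', add_smul, one_smul]
    abel
  rw [dist_eq_norm, e, norm_smul, norm_inv, Real.norm_of_nonneg hpos.le]
  have hle : (l.length : ℝ) ≤ N := by exact_mod_cast hN
  have : ((l.length : ℝ) + 1)⁻¹ * l.length ≤ N / (N + 1) := by
    rw [inv_mul_eq_div, div_le_div_iff₀ hpos (by positivity)]; nlinarith
  calc ((l.length : ℝ) + 1)⁻¹ * ‖(l.length : ℝ) • v.1 - (m.map Prod.fst).sum‖
      ≤ ((l.length : ℝ) + 1)⁻¹ * (l.length * δ) := by gcongr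
    _ = (((l.length : ℝ) + 1)⁻¹ * l.length) * δ := by ring
    _ ≤ _ := by gcongr

lemma barycenter_mem {S : Set V} (hS : Convex ℝ S) {x : V × T} {l : List (V × T)}
    (h : ∀ v ∈ x :: l, v.1 ∈ S) : (barycenter x l).1 ∈ S := by
  have key : ∀ (l : List (V × T)), (∀ v ∈ x :: l, v.1 ∈ S) →
      ∃ y ∈ S, ((x :: l).map Prod.fst).sum = ((l.length : ℝ) + 1) • y := by
    intro l hl
    induction l with
    | nil => exact ⟨x.1, hl x (by simp), by simp⟩
    | cons w l ih =>
      obtain ⟨y, hy, e⟩ := ih fun v hv => hl v (by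
        rcases List.mem_cons.1 hv with rfl | hv <;> simp [*])
      have hp : (0 : ℝ) < l.length + 1 + 1 := by positivity
      refine ⟨((l.length + 1 : ℝ) / (l.length + 1 + 1)) • y + (1 / (l.length + 1 + 1 : ℝ)) • w.1,
        hS hy (hl w (by simp)) (by positivity) (by positivity) (by field_simp), ?_⟩
      have : ((x :: w :: l).map Prod.fst).sum = ((x :: l).map Prod.fst).sum + w.1 := by
        simp; abel
      rw [this, e, List.length_cons, smul_add, smul_smul, smul_smul]
      push_cast
      rw [mul_div_cancel₀ _ hp.ne', mul_div_cancel₀ _ hp.ne', one_smul]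
  obtain ⟨y, hy, e⟩ := key l h
  have hpos : (0 : ℝ) < l.length + 1 := by positivity
  rw [barycenter, e, inv_smul_smul₀ hpos.ne']
  exact hy

/-- The lists of `n` points with pairwise distances at most `δ`, lying in a common member of `𝒬`. -/
def smallLists (𝒬 : Set (Set V)) (δ : ℝ) (n : ℕ) : Set (List (V × T)) :=
  {l | l.length = n ∧ (∃ S ∈ 𝒬, ∀ v ∈ l, v.1 ∈ S) ∧ ∀ v ∈ l, ∀ w ∈ l, dist v.1 w.1 ≤ δ}

lemma subdivide_single_mem_on {N n : ℕ} {δ : ℝ} (hδ : 0 ≤ δ) {S : Set V} (hS : Convex ℝ S)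
    {l : List (V × T)} (hl : l.length = n) (hN : n ≤ N + 1) (hlS : ∀ v ∈ l, v.1 ∈ S)
    (hld : ∀ v ∈ l, ∀ w ∈ l, dist v.1 w.1 ≤ δ) :
    subdivide barycenter n (Finsupp.single l (1 : F)) ∈
      on F (smallLists {S} (N / (N + 1) * δ) n) := by
  induction n generalizing l S with
  | zero =>
    obtain rfl := List.length_eq_zero_iff.1 hl
    rw [subdivide_nil]
    exact single_mem_on (by simp [smallLists]) 1
  | succ n ih =>
    obtain _ | ⟨x, l⟩ := l
    · simp at hl
    rw [subdivide_succ_cons]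
    have hln : l.length = n := by simpa using hl
    set c := (barycenter x l).1 with hc
    set S' := S ∩ Metric.closedBall c (N / (N + 1) * δ) with hS'
    have hball : ∀ v ∈ x :: l, dist v.1 c ≤ N / (N + 1) * δ := fun v hv =>
      dist_barycenter_le hδ hv (by omega) (hld v hv)
    refine cone_mem_on (S := smallLists {S'} (N / (N + 1) * δ) n)
      (map_mem_on_of_single (bd_single_mem_on _) fun m hm => ?_) ?_
    · refine ih (hS.inter (convex_closedBall _ _)) (by have := hm.2; omega) (by omega) ?_ ?_
      · exact fun v hv => ⟨hlS v (hm.1.subset hv), hball v (hm.1.subset hv)⟩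
      · exact fun v hv w hw => hld v (hm.1.subset hv) w (hm.1.subset hw)
    · rintro m ⟨h1, ⟨_, rfl, h2⟩, h3⟩
      refine ⟨by simp [h1], ⟨S, rfl, ?_⟩, ?_⟩
      · intro v hv
        rcases List.mem_cons.1 hv with rfl | hv
        · exact barycenter_mem hS hlS
        · exact (h2 v hv).1
      · intro v hv w hw
        rcases List.mem_cons.1 hv with rfl | hv <;> rcases List.mem_cons.1 hw with rfl | hw
        · rw [dist_self]; positivity
        · rw [dist_comm]; exact (h2 w hw).2
        · exact (h2 v hv).2
        · exact h3 v hv w hw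

lemma subdivide_mem_on {N n : ℕ} {δ : ℝ} (hδ : 0 ≤ δ) {𝒬 : Set (Set V)}
    (h𝒬 : ∀ S ∈ 𝒬, Convex ℝ S) (hN : n ≤ N + 1) {z : Chain F (V × T)}
    (hz : z ∈ on F (smallLists 𝒬 δ n)) :
    subdivide barycenter n z ∈ on F (smallLists 𝒬 (N / (N + 1) * δ) n) := by
  refine map_mem_on_of_single hz ?_
  rintro l ⟨h1, ⟨S, hS, h2⟩, h3⟩
  refine Finsupp.supported_mono ?_ (subdivide_single_mem_on hδ (h𝒬 S hS) h1 hN h2 h3)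
  rintro m ⟨h1', ⟨S', hS', h2'⟩, h3'⟩
  exact ⟨h1', ⟨S', Set.mem_singleton_iff.1 hS' ▸ hS, h2'⟩, h3'⟩

variable {ι : Type*} [Fintype ι] [LinearOrder ι]

/-- A family of chains indexed by multidegrees of total degree at most `N`, forming a chain map
from a product of periodic resolutions. -/
def IsResolution {X : Type*} (p : ℕ) (g : ι → X → X) (N : ℕ) (h : (ι →₀ ℕ) → Chain F X) : Prop :=
  (∃ v, h 0 = Finsupp.single [v] 1) ∧ ∀ a : ι →₀ ℕ, a.degree ≤ N → a ≠ 0 → bd (h a) =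
    ∑ i ∈ a.support, koszulSign F i a • periodic p (map (g i)) (a i) (h (a - Finsupp.single i 1))

/-- A resolution can be subdivided until all its lists are small. -/
lemma exists_small_resolution {p N : ℕ} {g : ι → V × T → V × T}
    (hg : ∀ i x l, barycenter (g i x) (l.map (g i)) = g i (barycenter x l))
    {𝒬 : Set (Set V)} (h𝒬 : ∀ S ∈ 𝒬, Convex ℝ S) {D : ℝ} (hD : 0 ≤ D)
    {h : (ι →₀ ℕ) → Chain F (V × T)} (hres : IsResolution p g N h)
    (hsm : ∀ a : ι →₀ ℕ, a.degree ≤ N → h a ∈ on F (smallLists 𝒬 D (a.degree + 1)))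
    {ε : ℝ} (hε : 0 < ε) :
    ∃ h' : (ι →₀ ℕ) → Chain F (V × T), IsResolution p g N h' ∧
      ∀ a : ι →₀ ℕ, a.degree ≤ N → h' a ∈ on F (smallLists 𝒬 ε (a.degree + 1)) := by
  set q : ℝ := N / (N + 1) with hq
  have hq0 : 0 ≤ q := by positivity
  have hq1 : q < 1 := by rw [hq, div_lt_one (by positivity)]; linarith
  have key : ∀ n : ℕ, ∃ h' : (ι →₀ ℕ) → Chain F (V × T), IsResolution p g N h' ∧
      ∀ a : ι →₀ ℕ, a.degree ≤ N → h' a ∈ on F (smallLists 𝒬 (q ^ n * D) (a.degree + 1)) := by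
    intro n
    induction n with
    | zero => exact ⟨h, hres, by simpa using hsm⟩
    | succ n ih =>
      obtain ⟨h', ⟨⟨v, hv⟩, h1⟩, h2⟩ := ih
      refine ⟨fun a => subdivide barycenter (a.degree + 1) (h' a), ⟨⟨barycenter v [], ?_⟩, ?_⟩, ?_⟩
      · simp only [map_zero, hv, subdivide_succ_cons, bd_single_cons]
        simp [subdivide_nil]
      · intro a ha ha0
        simp only [bd_subdivide, h1 a ha ha0, map_sum, map_smul]
        refine Finset.sum_congr rfl fun i hi => ?_
        rw [degree_sub_single hi]
        have := periodic_intertwine (F := F) (W := subdivide barycenter a.degree)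
          (U := map (g i)) (U' := map (g i)) (fun z => subdivide_map (hg i) _ z) p (a i)
          (h' (a - Finsupp.single i 1))
        rw [this]
      · intro a ha
        rw [pow_succ', mul_assoc]
        exact subdivide_mem_on (by positivity) h𝒬 (by omega) (h2 a ha)
  obtain ⟨n, hn⟩ := exists_pow_lt_of_lt_one (show 0 < ε / (D + 1) by positivity) hq1
  obtain ⟨h', h1, h2⟩ := key n
  refine ⟨h', h1, fun a ha => Finsupp.supported_mono ?_ (h2 a ha)⟩
  rintro l ⟨hl1, hl2, hl3⟩
  refine ⟨hl1, hl2, fun v hv w hw => (hl3 v hv w hw).trans ?_⟩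
  calc q ^ n * D ≤ q ^ n * (D + 1) := by gcongr; linarith
    _ ≤ ε / (D + 1) * (D + 1) := by gcongr
    _ = ε := by field_simp

end Barycenter

section Cochains

variable {F : Type*} [CommRing F] {X : Type*}

/-- The evaluation of a cochain on chains. -/
noncomputable def ev (θ : List X → F) : Chain F X →ₗ[F] F := Finsupp.linearCombination F θ

@[simp] lemma ev_single (θ : List X → F) (l : List X) (c : F) :
    ev θ (Finsupp.single l c) = c * θ l := by
  simp [ev]

/-- The coboundary of a cochain. -/
noncomputable def coboundary (θ : List X → F) (l : List X) : F := ev θ (bd (Finsupp.single l 1))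

lemma ev_coboundary (θ : List X → F) (z : Chain F X) : ev (coboundary θ) z = ev θ (bd z) := by
  have : ev (coboundary θ) = (ev θ ∘ₗ bd : Chain F X →ₗ[F] F) :=
    hom_ext fun l => by simp [coboundary]
  exact LinearMap.congr_fun this z

/-- Multiplication of a cochain by a function of the first point. -/
def vmul (a : X → F) (θ : List X → F) : List X → F
  | [] => 0
  | v :: l => a v * θ (v :: l)

/-- Multiplication of the shifted cochain by a function of the first two points. -/
def emul (q : X → X → F) (θ : List X → F) : List X → F
  | v :: w :: l => q v w * θ (w :: l)
  | _ => 0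

lemma ev_vmul_cone (a : X → F) (θ : List X → F) (v : X) (z : Chain F X) :
    ev (vmul a θ) (cone v z) = a v * ev θ (cone v z) := by
  have : ev (vmul a θ) ∘ₗ cone v = (a v • (ev θ ∘ₗ cone v) : Chain F X →ₗ[F] F) :=
    hom_ext fun l => by simp [vmul]
  exact LinearMap.congr_fun this z

lemma ev_emul_cone (q : X → X → F) (θ : List X → F) (v : X) (z : Chain F X) :
    ev (emul q θ) (cone v z) = ev (vmul (q v) θ) z := by
  have : ev (emul q θ) ∘ₗ cone v = (ev (vmul (q v) θ) : Chain F X →ₗ[F] F) :=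
    hom_ext fun l => by cases l <;> simp [vmul, emul]
  exact LinearMap.congr_fun this z

lemma ev_map {θ θ' : List X → F} {f : X → X} (h : ∀ l, θ (l.map f) = θ' l) (z : Chain F X) :
    ev θ (map f z) = ev θ' z := by
  have : ev θ ∘ₗ map f = (ev θ' : Chain F X →ₗ[F] F) := hom_ext fun l => by simp [h]
  exact LinearMap.congr_fun this z

lemma ev_vmul_add (a b : X → F) (θ : List X → F) (z : Chain F X) :
    ev (vmul (fun x => a x + b x) θ) z = ev (vmul a θ) z + ev (vmul b θ) z := by
  have : ev (vmul (fun x => a x + b x) θ) = (ev (vmul a θ) + ev (vmul b θ) : Chain F X →ₗ[F] F) :=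
    hom_ext fun l => by cases l <;> simp [vmul, add_mul]
  exact LinearMap.congr_fun this z

lemma ev_vmul_sum {σ : Type*} (s : Finset σ) (a : σ → X → F) (θ : List X → F) (z : Chain F X) :
    ev (vmul (fun x => ∑ i ∈ s, a i x) θ) z = ∑ i ∈ s, ev (vmul (a i) θ) z := by
  have : ev (vmul (fun x => ∑ i ∈ s, a i x) θ) = (∑ i ∈ s, ev (vmul (a i) θ) : Chain F X →ₗ[F] F) :=
    hom_ext fun l => by cases l <;> simp [vmul, Finset.sum_mul, LinearMap.sum_apply]
  simpa [LinearMap.sum_apply] using LinearMap.congr_fun this z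

variable {θ : List X → F}

lemma nil_eq_zero (hθ : ∀ z, ev θ (bd z) = 0) [h : Nonempty X] : θ [] = 0 := by
  obtain ⟨v⟩ := h
  simpa [bd_single_cons] using hθ (Finsupp.single [v] 1)

lemma ev_vmul_const (hθ : ∀ z, ev θ (bd z) = 0) [Nonempty X] (c : F) (z : Chain F X) :
    ev (vmul (fun _ => c) θ) z = c * ev θ z := by
  have : ev (vmul (fun _ => c) θ) = (c • ev θ : Chain F X →ₗ[F] F) :=
    hom_ext fun l => by cases l <;> simp [vmul, nil_eq_zero hθ]
  exact LinearMap.congr_fun this z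

lemma coboundary_vmul_cons (hθ : ∀ z, ev θ (bd z) = 0) (a : X → F) (v w : X) (l : List X) :
    coboundary (vmul a θ) (v :: w :: l) = (a w - a v) * θ (w :: l) := by
  have h := hθ (Finsupp.single (v :: w :: l) 1)
  rw [bd_single_cons, map_sub, sub_eq_zero, ev_single, one_mul] at h
  rw [coboundary, bd_single_cons, map_sub, ev_vmul_cone, ← h, ev_single]
  simp [vmul]; ring

lemma coboundary_vmul_single (a : X → F) (v : X) :
    coboundary (vmul a θ) [v] = 0 := by
  simp [coboundary, bd_single_cons, vmul]

lemma coboundary_emul_cons (hθ : ∀ z, ev θ (bd z) = 0) (q : X → X → F) (v w x : X) (l : List X) :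
    coboundary (emul q θ) (v :: w :: x :: l) = (q w x - q v x + q v w) * θ (x :: l) := by
  have h := coboundary_vmul_cons hθ (q v) w x l
  rw [coboundary] at h
  rw [coboundary, bd_single_cons, map_sub, ev_emul_cone, h, ev_single]
  simp [emul]; ring

lemma coboundary_emul_pair (q : X → X → F) (v w : X) :
    coboundary (emul q θ) [v, w] = 0 := by
  rw [coboundary, bd_single_cons, map_sub, ev_emul_cone]
  simp [emul, bd_single_cons, vmul]

lemma coboundary_emul_single (q : X → X → F) (v : X) : coboundary (emul q θ) [v] = 0 := by
  simp [coboundary, bd_single_cons, emul]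

lemma coboundary_nil : coboundary θ [] = 0 := by
  simp [coboundary]

/-- The cochain that is `1` on single points. -/
def unitCochain : List X → F := fun l => if l.length = 1 then 1 else 0

lemma ev_unitCochain_bd (z : Chain F X) : ev unitCochain (bd z) = 0 := by
  have h1 : ∀ (v : X) (z : Chain F X), ev unitCochain (cone v z) = z [] := by
    intro v z
    have : ev unitCochain ∘ₗ cone v = (Finsupp.lapply [] : Chain F X →ₗ[F] F) :=
      hom_ext fun l => by cases l <;> simp [unitCochain]
    exact LinearMap.congr_fun this z
  have : ev unitCochain ∘ₗ bd = (0 : Chain F X →ₗ[F] F) := by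
    refine hom_ext fun l => ?_
    obtain _ | ⟨v, _ | ⟨w, l⟩⟩ := l
    · simp
    · simp [bd_single_cons, unitCochain]
    · simp only [LinearMap.comp_apply, LinearMap.zero_apply]
      rw [bd_single_cons, map_sub, h1, bd_single_cons]
      have : (cone w (bd (Finsupp.single l (1 : F))) : Chain F X) [] = 0 := by
        have h := cone_mem_on (x := w) (T := {m | m ≠ []}) (bd_single_mem_on (F := F) l) (by simp)
        by_contra hne
        exact h (Finsupp.mem_support_iff.2 hne) rfl
      rw [Finsupp.sub_apply, this]
      cases l <;> simp [unitCochain]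
  exact LinearMap.congr_fun this z

end Cochains

lemma iterate_inv {p : ℕ} {X : Type*} {θ : List X → ZMod p} {f : X → X}
    (hf : ∀ l, θ (l.map f) = θ l) (s : ℕ) (l : List X) :
    θ (l.map f^[s]) = θ l := by
  induction s with
  | zero => simp
  | succ s ih => rw [Function.iterate_succ', ← List.map_map, hf, ih]

section Steps

variable {p : ℕ} [hp : Fact p.Prime] {X : Type*} {θ : List X → ZMod p}

lemma sum_range_zmod {M : Type*} [AddCommMonoid M] (f : ZMod p → M) :
    ∑ s ∈ Finset.range p, f s = ∑ y, f y := by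
  refine Finset.sum_bij (fun s _ => (s : ZMod p)) (fun _ _ => Finset.mem_univ _) ?_ ?_
    (fun _ _ => rfl)
  · intro s hs t ht h
    rw [Finset.mem_range] at hs ht
    simpa [ZMod.val_natCast, Nat.mod_eq_of_lt, hs, ht] using congrArg ZMod.val h
  · exact fun y _ => ⟨y.val, Finset.mem_range.2 (ZMod.val_lt y), by simp⟩

lemma sum_range_cast : ∑ s ∈ Finset.range p, (s : ZMod p) = if p = 2 then 1 else 0 := by
  split_ifs with h
  · subst h; simp [Finset.sum_range_succ]
  · have h1 := congrArg (Nat.cast : ℕ → ZMod p) (Finset.sum_range_id_mul_two p)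
    push_cast at h1
    rw [CharP.cast_eq_zero, zero_mul] at h1
    refine (mul_eq_zero.1 h1).resolve_right fun h2 => h ?_
    have : p ∣ 2 := by rw [← CharP.cast_eq_zero_iff (ZMod p) p]; exact_mod_cast h2
    exact (Nat.prime_dvd_prime_iff_eq hp.out Nat.prime_two).1 this

/-- The carry in the addition of two residues. -/
def carry (x c : ZMod p) : ℕ := (x.val + c.val) / p

lemma carry_spec (x c : ZMod p) : p * carry x c + (x + c).val = x.val + c.val := by
  rw [ZMod.val_add, carry, Nat.div_add_mod]

lemma sum_carry (x c : ZMod p) :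
    ((∑ s ∈ Finset.range p, carry x (s * c) : ℕ) : ZMod p) = if c = 0 then 0 else x := by
  split_ifs with hc
  · have : ∀ s : ℕ, carry x (s * c) = 0 := fun s => by
      simp [carry, hc, Nat.div_eq_of_lt (ZMod.val_lt x)]
    simp [this]
  · have h1 : ∑ s ∈ Finset.range p, ((s * c : ZMod p)).val = ∑ y : ZMod p, y.val := by
      rw [sum_range_zmod fun y : ZMod p => (y * c).val]
      exact Equiv.sum_comp (Equiv.mulRight₀ c hc) _
    have h2 : ∑ s ∈ Finset.range p, (x + s * c : ZMod p).val = ∑ y : ZMod p, y.val := by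
      rw [sum_range_zmod fun y : ZMod p => (x + y * c).val]
      exact Equiv.sum_comp ((Equiv.mulRight₀ c hc).trans (Equiv.addLeft x)) _
    have h3 : ∑ s ∈ Finset.range p, (p * carry x (s * c) + (x + s * c).val) =
        ∑ s ∈ Finset.range p, (x.val + (s * c : ZMod p).val) :=
      Finset.sum_congr rfl fun s _ => carry_spec _ _
    rw [Finset.sum_add_distrib, Finset.sum_add_distrib, h1, h2, Finset.sum_const,
      Finset.card_range, ← Finset.mul_sum, smul_eq_mul] at h3
    have h4 : ∑ s ∈ Finset.range p, carry x (s * c) = x.val :=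
      Nat.eq_of_mul_eq_mul_left hp.out.pos (Nat.add_right_cancel h3)
    rw [h4]; simp

/-- The defect of lifting differences of labels to integers of least absolute value. -/
noncomputable def defect (a : X → ZMod p) (v w : X) : ℤ :=
  (((a w).val - (a v).val : ℤ) - (a w - a v).valMinAbs) / p

lemma defect_spec (a : X → ZMod p) (v w : X) :
    (p : ℤ) * defect a v w = ((a w).val - (a v).val : ℤ) - (a w - a v).valMinAbs := by
  refine Int.mul_ediv_cancel' ?_
  rw [← ZMod.intCast_zmod_eq_zero_iff_dvd]
  simp

lemma defect_map {a : X → ZMod p} {f : X → X} {c : ZMod p} (ha : ∀ x, a (f x) = a x + c) (v w : X) :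
    defect a (f v) (f w) = defect a v w - (carry (a w) c - carry (a v) c) := by
  have hp0 : (p : ℤ) ≠ 0 := by exact_mod_cast hp.out.ne_zero
  apply mul_left_cancel₀ hp0
  have h1 : (p : ℤ) * carry (a v) c + (a v + c).val = (a v).val + c.val := by
    exact_mod_cast carry_spec (a v) c
  have h2 : (p : ℤ) * carry (a w) c + (a w + c).val = (a w).val + c.val := by
    exact_mod_cast carry_spec (a w) c
  rw [mul_sub, mul_sub, defect_spec, defect_spec, ha, ha, add_sub_add_right_eq_sub]
  linarith

lemma map_pow (f : X → X) (s : ℕ) (z : Chain (ZMod p) X) :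
    ((map f : Module.End (ZMod p) (Chain (ZMod p) X)) ^ s) z = map f^[s] z := by
  induction s with
  | zero =>
    have : (map id : Chain (ZMod p) X →ₗ[ZMod p] _) = LinearMap.id := hom_ext fun l => by simp
    simp [this]
  | succ s ih =>
    rw [pow_succ', Module.End.mul_apply, ih, map_map, Function.iterate_succ']

lemma iterate_label {a : X → ZMod p} {f : X → X} {c : ZMod p} (ha : ∀ x, a (f x) = a x + c)
    (s : ℕ) (x : X) : a (f^[s] x) = a x + s * c := by
  induction s with
  | zero => simp
  | succ s ih => rw [Function.iterate_succ_apply', ha, ih]; push_cast; ring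

lemma ev_emul_map (hθ : ∀ z, ev θ (bd z) = 0) {f : X → X} (hf : ∀ l, θ (l.map f) = θ l)
    {a : X → ZMod p} {c : ZMod p} (ha : ∀ x, a (f x) = a x + c) (z : Chain (ZMod p) X) :
    ev (emul (fun v w => (defect a v w : ZMod p)) θ) (map f z) =
      ev (emul (fun v w => (defect a v w : ZMod p)) θ) z -
        ev (vmul (fun x => (carry (a x) c : ZMod p)) θ) (bd z) := by
  rw [← ev_coboundary]
  have hsub : ∀ (A B : List X → ZMod p), ev (fun l => A l - B l) z = ev A z - ev B z := by
    intro A B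
    have : ev (fun l => A l - B l) = (ev A - ev B : Chain (ZMod p) X →ₗ[ZMod p] ZMod p) :=
      hom_ext fun l => by simp
    exact LinearMap.congr_fun this z
  rw [← hsub]
  refine ev_map (fun l => ?_) z
  obtain _ | ⟨v, _ | ⟨w, l⟩⟩ := l
  · simp [emul, coboundary_nil]
  · simp [emul, coboundary_vmul_single]
  · have := hf (w :: l)
    rw [List.map_cons] at this
    rw [coboundary_vmul_cons hθ]
    simp [emul, this, defect_map ha]
    ring

variable [Nonempty X]

lemma ev_vmul_map (hθ : ∀ z, ev θ (bd z) = 0) {f : X → X} (hf : ∀ l, θ (l.map f) = θ l)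
    {a : X → ZMod p} {c : ZMod p} (ha : ∀ x, a (f x) = a x + c) (z : Chain (ZMod p) X) :
    ev (vmul a θ) (map f z) = ev (vmul a θ) z + c * ev θ z := by
  rw [← ev_vmul_const hθ, ← ev_vmul_add]
  refine ev_map (fun l => ?_) z
  cases l with
  | nil => simp [vmul]
  | cons v l =>
    have := hf (v :: l)
    rw [List.map_cons] at this ⊢
    simp [vmul, ha, this]

lemma ev_vmul_periodic_odd (hθ : ∀ z, ev θ (bd z) = 0) {f : X → X} (hf : ∀ l, θ (l.map f) = θ l)
    {a : X → ZMod p} {c : ZMod p} (ha : ∀ x, a (f x) = a x + c) {b : ℕ} (hb : Odd b)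
    (z : Chain (ZMod p) X) : ev (vmul a θ) (periodic p (map f) b z) = c * ev θ z := by
  rw [periodic_of_odd hb, map_sub, ev_vmul_map hθ hf ha]
  ring

lemma ev_vmul_periodic_even (hθ : ∀ z, ev θ (bd z) = 0) {f : X → X} (hf : ∀ l, θ (l.map f) = θ l)
    {a : X → ZMod p} {c : ZMod p} (ha : ∀ x, a (f x) = a x + c) {b : ℕ} (hb : Even b)
    (z : Chain (ZMod p) X) :
    ev (vmul a θ) (periodic p (map f) b z) = if p = 2 then c * ev θ z else 0 := by
  have : ∀ s : ℕ, ev (vmul a θ) (map f^[s] z) = ev (vmul a θ) z + s * (c * ev θ z) := fun s => by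
    rw [ev_vmul_map hθ (iterate_inv hf s) (iterate_label ha s), mul_assoc]
  rw [periodic_of_even hb, map_sum]
  simp only [map_pow, this]
  rw [Finset.sum_add_distrib, ← Finset.sum_mul, sum_range_cast]
  split_ifs <;> simp

lemma ev_emul_periodic_even (hθ : ∀ z, ev θ (bd z) = 0) {f : X → X} (hf : ∀ l, θ (l.map f) = θ l)
    {a : X → ZMod p} {c : ZMod p} (ha : ∀ x, a (f x) = a x + c) {b : ℕ} (hb : Even b)
    (z : Chain (ZMod p) X) :
    ev (emul (fun v w => (defect a v w : ZMod p)) θ) (periodic p (map f) b z) =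
      if c = 0 then 0 else - ev (vmul a θ) (bd z) := by
  rw [periodic_of_even hb, map_sum]
  simp only [map_pow, ev_emul_map hθ (iterate_inv hf _) (iterate_label ha _)]
  rw [Finset.sum_sub_distrib, ← ev_vmul_sum]
  have h : (fun x => ∑ s ∈ Finset.range p, (carry (a x) (s * c) : ZMod p)) =
      fun x => if c = 0 then 0 else a x := by
    funext x
    rw [← sum_carry]; push_cast; rfl
  rw [h]
  split_ifs with hc
  · rw [ev_vmul_const hθ]; simp
  · simp

end Steps

section Fold

variable {p : ℕ} [hp : Fact p.Prime] {X : Type*}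

/-- Multiplication of a cocycle by the characteristic class of a label: of degree one for `p = 2`
and of degree two for odd `p`. -/
noncomputable def step (p : ℕ) [Fact p.Prime] {X : Type*} (a : X → ZMod p) (θ : List X → ZMod p) :
    List X → ZMod p :=
  coboundary (if p = 2 then vmul a θ else emul (fun v w => (defect a v w : ZMod p)) θ)

/-- The degree of the characteristic class of a label. -/
def stepDegree (p : ℕ) : ℕ := if p = 2 then 1 else 2

lemma ev_step_bd (a : X → ZMod p) (θ : List X → ZMod p) (z : Chain (ZMod p) X) :
    ev (step p a θ) (bd z) = 0 := by
  rw [step, ev_coboundary, bd_bd, map_zero]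

lemma step_map [Nonempty X] {a : X → ZMod p} {θ : List X → ZMod p}
    (hθ : ∀ z, ev θ (bd z) = 0) {f : X → X} (hf : ∀ l, θ (l.map f) = θ l)
    {c : ZMod p} (ha : ∀ x, a (f x) = a x + c) (l : List X) :
    step p a θ (l.map f) = step p a θ l := by
  have hev : ∀ z, ev θ (map f z) = ev θ z := ev_map hf
  have h : (Finsupp.single (l.map f) 1 : Chain (ZMod p) X) = map f (Finsupp.single l 1) := by simp
  rw [step, coboundary, coboundary, h, bd_map]
  split_ifs with hp2
  · rw [ev_vmul_map hθ hf ha, hθ, mul_zero, add_zero]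
  · rw [ev_emul_map hθ hf ha, bd_bd, map_zero, sub_zero]

/-- The label `a` is constant on `U`, up to steps of one in the case of odd `p`. -/
def NearConstant (a : X → ZMod p) (U : Set X) : Prop :=
  ∃ s, ∀ x ∈ U, a x = s ∨ p ≠ 2 ∧ a x = s + 1

lemma defect_cocycle {a : X → ZMod p} (hp2 : p ≠ 2) {s : ZMod p} {v w x : X}
    (hv : a v = s ∨ a v = s + 1) (hw : a w = s ∨ a w = s + 1) (hx : a x = s ∨ a x = s + 1) :
    (defect a w x : ZMod p) - defect a v x + defect a v w = 0 := by
  have h3 : 3 ≤ p := by have := hp.out.two_le; omega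
  have h1 : (1 : ZMod p).valMinAbs = 1 := by
    have : ((1 : ℕ) : ZMod p).valMinAbs = (1 : ℕ) := ZMod.valMinAbs_natCast_of_le_half (by omega)
    simpa using this
  have hneg : (-1 : ZMod p).valMinAbs = -1 := by
    rw [ZMod.valMinAbs_neg_of_ne_half, h1]
    rw [ZMod.val_one_eq_one_mod, Nat.mod_eq_of_lt (by omega)]
    omega
  have hp0 : (p : ℤ) ≠ 0 := by exact_mod_cast hp.out.ne_zero
  have key : defect a w x - defect a v x + defect a v w = 0 := by
    apply mul_left_cancel₀ hp0
    rw [mul_add, mul_sub, defect_spec, defect_spec, defect_spec]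
    have : (a x - a w).valMinAbs - (a x - a v).valMinAbs + (a w - a v).valMinAbs = 0 := by
      rcases hv with hv | hv <;> rcases hw with hw | hw <;> rcases hx with hx | hx <;>
        simp [hv, hw, hx, h1, hneg]
    linarith
  exact_mod_cast congrArg (Int.cast : ℤ → ZMod p) key

lemma step_eq_zero_of_nearConstant {a : X → ZMod p} {θ : List X → ZMod p}
    (hθ : ∀ z, ev θ (bd z) = 0) {U : Set X} (ha : NearConstant a U) {l : List X}
    (hl : ∀ x ∈ l, x ∈ U) : step p a θ l = 0 := by
  obtain ⟨s, hs⟩ := ha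
  rw [step]
  split_ifs with hp2
  · obtain _ | ⟨v, _ | ⟨w, l⟩⟩ := l
    · exact coboundary_nil
    · exact coboundary_vmul_single _ _
    · have hv := hs v (hl v (by simp))
      have hw := hs w (hl w (by simp))
      simp only [ne_eq, hp2, not_true_eq_false, false_and, or_false] at hv hw
      rw [coboundary_vmul_cons hθ, hv, hw, sub_self, zero_mul]
  · obtain _ | ⟨v, _ | ⟨w, _ | ⟨x, l⟩⟩⟩ := l
    · exact coboundary_nil
    · exact coboundary_emul_single _ _
    · exact coboundary_emul_pair _ _ _
    · have hv := hs v (hl v (by simp))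
      have hw := hs w (hl w (by simp))
      have hx := hs x (hl x (by simp))
      simp only [ne_eq, hp2, not_false_eq_true, true_and] at hv hw hx
      rw [coboundary_emul_cons hθ, defect_cocycle hp2 hv hw hx, zero_mul]

lemma step_eq_zero_of_forall {a : X → ZMod p} {θ : List X → ZMod p}
    (hθ : ∀ z, ev θ (bd z) = 0) {U : Set X} (hU : ∀ l : List X, (∀ x ∈ l, x ∈ U) → θ l = 0)
    {l : List X} (hl : ∀ x ∈ l, x ∈ U) : step p a θ l = 0 := by
  rw [step]
  split_ifs with hp2
  · obtain _ | ⟨v, _ | ⟨w, l⟩⟩ := l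
    · exact coboundary_nil
    · exact coboundary_vmul_single _ _
    · rw [coboundary_vmul_cons hθ, hU _ fun x hx => hl x (List.mem_cons_of_mem _ hx), mul_zero]
  · obtain _ | ⟨v, _ | ⟨w, _ | ⟨x, l⟩⟩⟩ := l
    · exact coboundary_nil
    · exact coboundary_emul_single _ _
    · exact coboundary_emul_pair _ _ _
    · rw [coboundary_emul_cons hθ, hU _ fun x hx =>
        hl x (List.mem_cons_of_mem _ (List.mem_cons_of_mem _ hx)), mul_zero]

lemma two_smul_sub {ι : Type*} (c : ι →₀ ℕ) (i : ι) :
    2 • c - Finsupp.single i 1 - Finsupp.single i 1 = 2 • (c - Finsupp.single i 1) := by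
  ext l
  simp only [Finsupp.coe_tsub, Finsupp.coe_smul, Pi.sub_apply, Pi.smul_apply, smul_eq_mul]
  rw [Nat.mul_sub, Nat.sub_sub, two_mul (Finsupp.single i 1 l)]

lemma degree_sub_single_le {ι : Type*} {a : ι →₀ ℕ} {N : ℕ} (ha : a.degree ≤ N) (i : ι) :
    (a - Finsupp.single i 1).degree ≤ N :=
  (Finsupp.degree_mono tsub_le_self).trans ha

/-- The product of the classes of a list of labels. -/
noncomputable def classProduct {ι : Type*} (L : List ((ι → ZMod p) × (X → ZMod p))) :
    List X → ZMod p :=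
  L.foldr (fun A θ => step p A.2 θ) unitCochain

lemma ev_classProduct_bd {ι : Type*} (L : List ((ι → ZMod p) × (X → ZMod p)))
    (z : Chain (ZMod p) X) :
    ev (classProduct L) (bd z) = 0 := by
  cases L
  · exact ev_unitCochain_bd z
  · exact ev_step_bd _ _ z

/-- The linear form with the given coefficients. -/
noncomputable def linearForm {ι : Type*} [Fintype ι] (χ : ι → ZMod p) : MvPolynomial ι (ZMod p) :=
  ∑ i, MvPolynomial.C (χ i) * MvPolynomial.X i

lemma isHomogeneous_linearForm {ι : Type*} [Fintype ι] (χ : ι → ZMod p) :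
    (linearForm χ).IsHomogeneous 1 :=
  MvPolynomial.IsHomogeneous.sum _ _ _ fun i _ => by
    simpa using (MvPolynomial.isHomogeneous_C ι (χ i)).mul (MvPolynomial.isHomogeneous_X _ i)

lemma classProduct_map [Nonempty X] {ι : Type*} {g : ι → X → X}
    (L : List ((ι → ZMod p) × (X → ZMod p)))
    (hL : ∀ A ∈ L, ∀ i x, A.2 (g i x) = A.2 x + A.1 i) (i : ι) (l : List X) :
    classProduct L (l.map (g i)) = classProduct L l := by
  induction L generalizing l with
  | nil => simp [classProduct, unitCochain]
  | cons A L ih =>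
    exact step_map (ev_classProduct_bd L) (ih fun A hA => hL A (List.mem_cons_of_mem _ hA))
      (hL A List.mem_cons_self i) l

lemma classProduct_eq_zero {ι : Type*} {L : List ((ι → ZMod p) × (X → ZMod p))} {U : Set X}
    (hU : ∃ A ∈ L, NearConstant A.2 U) {l : List X} (hl : ∀ x ∈ l, x ∈ U) :
    classProduct L l = 0 := by
  induction L generalizing l with
  | nil => simp at hU
  | cons A L ih =>
    obtain ⟨B, hB, hBU⟩ := hU
    rcases List.mem_cons.1 hB with rfl | hB
    · exact step_eq_zero_of_nearConstant (ev_classProduct_bd L) hBU hl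
    · exact step_eq_zero_of_forall (ev_classProduct_bd L) (fun l hl => ih ⟨B, hB, hBU⟩ hl) hl

variable {ι : Type*} [Fintype ι] [LinearOrder ι] [Nonempty X] {g : ι → X → X} {N : ℕ}
  {h : (ι →₀ ℕ) → Chain (ZMod p) X}

/-- Multiplication by the class of a label acts on a resolution as multiplication by a linear
form. -/
lemma ev_step (hres : IsResolution p g N h) {θ : List X → ZMod p}
    (hθ : ∀ z, ev θ (bd z) = 0) (hf : ∀ i l, θ (l.map (g i)) = θ l)
    {a : X → ZMod p} {χ : ι → ZMod p} (ha : ∀ i x, a (g i x) = a x + χ i) {c : ι →₀ ℕ}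
    (hc0 : c ≠ 0) (hc : (stepDegree p • c).degree ≤ N) :
    ev (step p a θ) (h (stepDegree p • c)) = (if p = 2 then 1 else -1) *
      ∑ i ∈ c.support, χ i * ev θ (h (stepDegree p • (c - Finsupp.single i 1))) := by
  rw [step, ev_coboundary]
  by_cases hp2 : p = 2
  · simp only [stepDegree, if_pos hp2, one_smul, one_mul] at hc ⊢
    rw [hres.2 c hc hc0, map_sum]
    refine Finset.sum_congr rfl fun i _ => ?_
    have hone : koszulSign (ZMod p) i c = 1 := by subst hp2; exact one_pow _
    rw [hone, one_smul]
    rcases Nat.even_or_odd (c i) with hi | hi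
    · rw [ev_vmul_periodic_even hθ (hf i) (ha i) hi, if_pos hp2]
    · rw [ev_vmul_periodic_odd hθ (hf i) (ha i) hi]
  · simp only [stepDegree, if_neg hp2] at hc ⊢
    have hne : 2 • c ≠ 0 := by simpa using hc0
    rw [hres.2 _ hc hne, map_sum, Finset.mul_sum]
    have hsupp : (2 • c).support = c.support := by ext; simp
    rw [hsupp]
    refine Finset.sum_congr rfl fun i hi => ?_
    have hone : koszulSign (ZMod p) i (2 • c) = 1 := by
      refine Even.neg_one_pow ?_
      simp [← Finset.mul_sum]
    have heven : Even ((2 • c) i) := by simp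
    rw [hone, one_smul, ev_emul_periodic_even hθ (hf i) (ha i) heven]
    split_ifs with hχ
    · simp [hχ]
    · rw [neg_one_mul, neg_inj]
      have hci := Finsupp.mem_support_iff.1 hi
      have hne' : 2 • c - Finsupp.single i 1 ≠ 0 := fun h0 => by
        have := DFunLike.congr_fun h0 i
        simp at this
        omega
      rw [hres.2 _ (degree_sub_single_le hc i) hne', map_sum]
      rw [Finset.sum_eq_single i]
      · have hone : koszulSign (ZMod p) i (2 • c - Finsupp.single i 1) = 1 := by
          refine Even.neg_one_pow ?_
          rw [Finset.sum_congr rfl (g := fun l => 2 * c l)]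
          · simp [← Finset.mul_sum]
          · intro l hl
            simp [(Finset.mem_filter.1 hl).2.ne]
        have hodd : Odd ((2 • c - Finsupp.single i 1 : ι →₀ ℕ) i) := by
          rw [Nat.odd_iff]
          simp
          omega
        rw [hone, one_smul, ev_vmul_periodic_odd hθ (hf i) (ha i) hodd, two_smul_sub]
      · intro l _ hli
        have he : Even ((2 • c - Finsupp.single i 1 : ι →₀ ℕ) l) := by
          simp [Finsupp.single_eq_of_ne hli]
        rw [map_smul, ev_vmul_periodic_even hθ (hf l) (ha l) he, if_neg hp2, smul_zero]
      · intro hi'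
        rw [Finsupp.notMem_support_iff] at hi'
        simp at hi'
        omega

lemma ev_classProduct (hres : IsResolution p g N h) (L : List ((ι → ZMod p) × (X → ZMod p)))
    (hL : ∀ A ∈ L, ∀ i x, A.2 (g i x) = A.2 x + A.1 i) (hN : stepDegree p * L.length ≤ N)
    (c : ι →₀ ℕ) (hc : c.degree = L.length) :
    ev (classProduct L) (h (stepDegree p • c)) = (if p = 2 then 1 else -1) ^ L.length *
      MvPolynomial.coeff c (L.map fun A => linearForm A.1).prod := by
  induction L generalizing c with
  | nil =>
    obtain rfl := (Finsupp.degree_eq_zero_iff c).1 hc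
    obtain ⟨v, hv⟩ := hres.1
    simp [classProduct, hv, unitCochain]
  | cons A L ih =>
    have hc0 : c ≠ 0 := by rintro rfl; simp at hc
    have hdeg : (stepDegree p • c).degree ≤ N := by rwa [map_nsmul, hc, smul_eq_mul]
    have hL' : ∀ B ∈ L, ∀ i x, B.2 (g i x) = B.2 x + B.1 i :=
      fun B hB => hL B (List.mem_cons_of_mem _ hB)
    have hstep : ev (classProduct (A :: L)) (h (stepDegree p • c)) = _ :=
      ev_step hres (ev_classProduct_bd L) (classProduct_map L hL') (hL A List.mem_cons_self)
        hc0 hdeg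
    rw [hstep, List.map_cons, List.prod_cons, linearForm, Finset.sum_mul, MvPolynomial.coeff_sum,
      List.length_cons, pow_succ', mul_assoc]
    congr 1
    rw [Finset.mul_sum]
    refine Finset.sum_subset_zero_on_sdiff (Finset.subset_univ c.support) (fun i hi => ?_)
      fun i hi => ?_
    · rw [mul_assoc, MvPolynomial.coeff_C_mul, MvPolynomial.coeff_X_mul',
        if_neg (Finset.mem_sdiff.1 hi).2, mul_zero, mul_zero]
    · rw [ih hL' ((Nat.mul_le_mul_left _ (Nat.le_succ _)).trans hN) (c - Finsupp.single i 1) (by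
          have := degree_sub_single hi
          rw [hc, List.length_cons] at this
          omega),
        mul_assoc, MvPolynomial.coeff_C_mul, MvPolynomial.coeff_X_mul', if_pos hi]
      ring

lemma linearForm_ne_zero {χ : ι → ZMod p} (hχ : χ ≠ 0) : linearForm χ ≠ 0 := by
  obtain ⟨i, hi⟩ := Function.ne_iff.1 hχ
  intro h0
  apply hi
  have := congrArg (MvPolynomial.coeff (Finsupp.single i 1)) h0
  rw [linearForm, MvPolynomial.coeff_sum] at this
  simpa [MvPolynomial.coeff_C_mul, MvPolynomial.coeff_X, Finsupp.single_left_inj] using this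

/-- There is no resolution all of whose lists have a nearly constant label, if the labels have
nontrivial characters and are not too many. -/
theorem not_forall_nearConstant (hres : IsResolution p g N h)
    (L : List ((ι → ZMod p) × (X → ZMod p)))
    (hL : ∀ A ∈ L, ∀ i x, A.2 (g i x) = A.2 x + A.1 i) (hL0 : ∀ A ∈ L, A.1 ≠ 0)
    (hN : stepDegree p * L.length ≤ N) {S : ℕ → Set (List X)}
    (hS : ∀ a : ι →₀ ℕ, a.degree ≤ N → h a ∈ on (ZMod p) (S (a.degree + 1)))
    (hnear : ∀ n, ∀ l ∈ S n, ∃ A ∈ L, NearConstant A.2 {x | x ∈ l}) : False := by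
  set P := (L.map fun A => linearForm A.1).prod with hP
  have hP0 : P ≠ 0 := by
    refine List.prod_ne_zero fun h0 => ?_
    obtain ⟨A, hA, h0⟩ := List.mem_map.1 h0
    exact linearForm_ne_zero (hL0 A hA) h0
  have hhom : P.IsHomogeneous L.length := by
    rw [hP]
    clear_value P
    clear hP hP0 hN hnear hL hL0
    induction L with
    | nil => exact MvPolynomial.isHomogeneous_one _ _
    | cons A L ih =>
      rw [List.map_cons, List.prod_cons, List.length_cons, add_comm]
      exact (isHomogeneous_linearForm A.1).mul ih
  obtain ⟨c, hc⟩ := MvPolynomial.ne_zero_iff.1 hP0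
  have hdeg : c.degree = L.length := by
    rw [Finsupp.degree_eq_weight_one]; exact hhom hc
  have h1 := ev_classProduct hres L hL hN c hdeg
  have h2 : ev (classProduct L) (h (stepDegree p • c)) = 0 := by
    have hd : (stepDegree p • c).degree ≤ N := by rwa [map_nsmul, hdeg, smul_eq_mul]
    have := map_mem_on_of_single (f := ev (classProduct L)) (P := ⊥) (hS _ hd) fun l hl => by
      rw [ev_single, classProduct_eq_zero (hnear _ l hl) fun x hx => hx]
      simp
    simpa using this
  rw [h1] at h2
  refine mul_ne_zero (pow_ne_zero _ ?_) hc h2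
  split_ifs <;> simp

end Fold

section Sector

variable {p : ℕ} [hp : Fact p.Prime]

/-- The sector of a complex number: the plane is cut into `p` congruent sectors around the origin,
which are numbered by residues modulo `p`. -/
noncomputable def sector (p : ℕ) (z : ℂ) : ZMod p := (⌊p * z.arg / (2 * Real.pi)⌋ : ℤ)

lemma sector_eq_of_angle {z : ℂ} {x : ℝ} (h : (z.arg : Real.Angle) = x) :
    sector p z = (⌊p * x / (2 * Real.pi)⌋ : ℤ) := by
  obtain ⟨k, hk⟩ := Real.Angle.angle_eq_iff_two_pi_dvd_sub.1 h
  have hpi := Real.pi_pos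
  have : p * z.arg / (2 * Real.pi) = p * x / (2 * Real.pi) + ((p * k : ℤ) : ℝ) := by
    rw [eq_add_of_sub_eq hk]; push_cast; field_simp; ring
  rw [sector, this, Int.floor_add_intCast]
  simp

lemma sector_mul_stdAddChar {z : ℂ} (hz : z ≠ 0) (c : ZMod p) :
    sector p (z * ZMod.stdAddChar c) = sector p z + c := by
  have hpi := Real.pi_pos
  have hp0 : (p : ℝ) ≠ 0 := by exact_mod_cast hp.out.ne_zero
  have hc : ZMod.stdAddChar c = Complex.exp ((2 * Real.pi * c.val / p : ℝ) * Complex.I) := by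
    have := ZMod.stdAddChar_coe (N := p) (c.val : ℤ)
    rw [Int.cast_natCast, ZMod.natCast_zmod_val] at this
    rw [this]
    congr 1
    push_cast
    ring
  have hang : ((z * ZMod.stdAddChar c).arg : Real.Angle) =
      ((z.arg + 2 * Real.pi * c.val / p : ℝ) : Real.Angle) := by
    rw [hc, Complex.arg_mul_coe_angle hz (Complex.exp_ne_zero _), Real.Angle.coe_add]
    congr 1
    have := Complex.arg_cos_add_sin_mul_I_coe_angle ((2 * Real.pi * c.val / p : ℝ) : Real.Angle)
    rw [Real.Angle.cos_coe, Real.Angle.sin_coe] at this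
    rw [Complex.exp_mul_I, ← Complex.ofReal_cos, ← Complex.ofReal_sin, this]
  rw [sector_eq_of_angle hang, sector]
  have : p * (z.arg + 2 * Real.pi * c.val / p) / (2 * Real.pi) =
      p * z.arg / (2 * Real.pi) + ((c.val : ℤ) : ℝ) := by
    push_cast; field_simp
  rw [this, Int.floor_add_intCast]
  simp

lemma exists_floor_near (x : ℝ) : ∃ n : ℤ, ∀ y : ℝ, |y - x| < 1 / 2 → ⌊y⌋ = n ∨ ⌊y⌋ = n + 1 := by
  have h1 := Int.floor_le x
  have h2 := Int.lt_floor_add_one x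
  by_cases h : x < ⌊x⌋ + 1 / 2
  · refine ⟨⌊x⌋ - 1, fun y hy => ?_⟩
    rw [abs_lt] at hy
    rcases lt_or_ge y ⌊x⌋ with hy' | hy'
    · left; rw [Int.floor_eq_iff]; push_cast; constructor <;> linarith
    · right; rw [Int.floor_eq_iff]; push_cast; constructor <;> linarith
  · refine ⟨⌊x⌋, fun y hy => ?_⟩
    rw [abs_lt] at hy
    rcases lt_or_ge y (⌊x⌋ + 1) with hy' | hy'
    · left; rw [Int.floor_eq_iff]; constructor <;> linarith
    · right; rw [Int.floor_eq_iff]; push_cast; constructor <;> linarith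

/-- Near a nonzero number at most two adjacent sectors occur, and near a nonzero real number on the
real line only one. -/
lemma exists_sector_near {z₀ : ℂ} (hz₀ : z₀ ≠ 0) (him₀ : p = 2 → z₀.im = 0) :
    ∃ s : ZMod p, ∀ᶠ z in nhds z₀, z ≠ 0 ∧ ((p = 2 → z.im = 0) →
      sector p z = s ∨ p ≠ 2 ∧ sector p z = s + 1) := by
  have hpi := Real.pi_pos
  have hp0 : (0 : ℝ) < p := by exact_mod_cast hp.out.pos
  obtain ⟨n, hn⟩ := exists_floor_near (p * z₀.arg / (2 * Real.pi))
  have hdiv : Filter.Tendsto (fun z : ℂ => z / z₀) (nhds z₀) (nhds 1) := by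
    have : ContinuousAt (fun z : ℂ => z / z₀) z₀ := by fun_prop (disch := assumption)
    simpa [ContinuousAt, div_self hz₀] using this
  have harg : Filter.Tendsto (fun z : ℂ => (z / z₀).arg) (nhds z₀) (nhds 0) := by
    have := (Complex.continuousAt_arg (x := 1) (by simp)).tendsto.comp hdiv
    rw [Complex.arg_one] at this
    exact this
  have hre : ∀ᶠ z : ℂ in nhds z₀, 0 < (z / z₀).re := by
    have := (Complex.continuous_re.tendsto 1).comp hdiv
    exact this.eventually (lt_mem_nhds (by simp))
  have hsmall : ∀ᶠ z : ℂ in nhds z₀, |(z / z₀).arg| < Real.pi / p := by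
    have := harg.abs
    rw [abs_zero] at this
    exact this.eventually (gt_mem_nhds (by positivity))
  refine ⟨if p = 2 then sector p z₀ else n, ?_⟩
  filter_upwards [hre, hsmall, isOpen_ne.mem_nhds hz₀] with z h1 h2 h3
  refine ⟨h3, fun him => ?_⟩
  have hang : (z.arg : Real.Angle) = ((z₀.arg + (z / z₀).arg : ℝ) : Real.Angle) := by
    rw [Real.Angle.coe_add, Complex.arg_div_coe_angle h3 hz₀]
    abel
  rw [sector_eq_of_angle hang]
  by_cases hp2 : p = 2
  · left
    have : (z / z₀).arg = 0 := by
      rw [Complex.arg_eq_zero_iff]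
      refine ⟨h1.le, ?_⟩
      simp [Complex.div_im, him hp2, him₀ hp2]
    rw [this, add_zero, if_pos hp2, sector]
  · rw [if_neg hp2]
    have hlt : |p * (z₀.arg + (z / z₀).arg) / (2 * Real.pi) - p * z₀.arg / (2 * Real.pi)| <
        1 / 2 := by
      have : p * (z₀.arg + (z / z₀).arg) / (2 * Real.pi) - p * z₀.arg / (2 * Real.pi) =
          p / (2 * Real.pi) * (z / z₀).arg := by ring
      rw [this, abs_mul, abs_of_pos (by positivity)]
      calc p / (2 * Real.pi) * |(z / z₀).arg| < p / (2 * Real.pi) * (Real.pi / p) := by gcongr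
        _ = 1 / 2 := by field_simp
    rcases hn _ hlt with h | h
    · left; rw [h]
    · right; exact ⟨hp2, by rw [h]; push_cast; rfl⟩

end Sector

section Fourier

variable {p : ℕ} [hp : Fact p.Prime] {ι J : Type*} [Fintype ι] [DecidableEq ι]

/-- The translation action on families of vectors indexed by a group, together with a tag. -/
def shift {G W : Type*} [AddCommGroup G] (g : G) (x : (G → W) × G) : (G → W) × G :=
  (fun s => x.1 (s - g), x.2 + g)

/-- A Fourier coefficient of a coordinate of a family of vectors. -/
noncomputable def fourierCoeff (χ : ι → ZMod p) (j : J) (y : (ι → ZMod p) → J → ℝ) : ℂ :=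
  ∑ s, (y s j : ℂ) * ZMod.stdAddChar (dotProduct χ s)

lemma fourierCoeff_shift (χ : ι → ZMod p) (j : J) (g : ι → ZMod p)
    (x : ((ι → ZMod p) → J → ℝ) × (ι → ZMod p)) :
    fourierCoeff χ j (shift g x).1 = fourierCoeff χ j x.1 * ZMod.stdAddChar (dotProduct χ g) := by
  rw [fourierCoeff, fourierCoeff, Finset.sum_mul]
  refine Fintype.sum_equiv (Equiv.subRight g) _ _ fun s => ?_
  have : dotProduct χ s = dotProduct χ (s - g) + dotProduct χ g := by
    rw [← dotProduct_add, sub_add_cancel]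
  simp only [shift, Equiv.subRight_apply]
  rw [this, AddChar.map_add_eq_mul, mul_assoc]

lemma fourierCoeff_neg (χ : ι → ZMod p) (j : J) (y : (ι → ZMod p) → J → ℝ) :
    fourierCoeff (-χ) j y = (starRingEnd ℂ) (fourierCoeff χ j y) := by
  rw [fourierCoeff, fourierCoeff, map_sum]
  refine Finset.sum_congr rfl fun s _ => ?_
  rw [map_mul, Complex.conj_ofReal, neg_dotProduct, AddChar.map_neg_eq_conj]

lemma sum_stdAddChar_dotProduct {u : ι → ZMod p} (hu : u ≠ 0) :
    ∑ χ : ι → ZMod p, (ZMod.stdAddChar (dotProduct χ u) : ℂ) = 0 := by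
  obtain ⟨i, hi⟩ := Function.ne_iff.1 hu
  rw [Pi.zero_apply] at hi
  let φ : (ι → ZMod p) →+ ZMod p :=
    { toFun := fun χ => dotProduct χ u
      map_zero' := zero_dotProduct u
      map_add' := fun a b => add_dotProduct a b u }
  refine AddChar.sum_eq_zero_of_ne_one (ψ := (ZMod.stdAddChar (N := p)).compAddMonoidHom φ) ?_
  rw [AddChar.ne_one_iff]
  refine ⟨Pi.single i (u i)⁻¹, fun h => ?_⟩
  have h1 : φ (Pi.single i (u i)⁻¹) = 1 := by simp [φ, hi]
  rw [AddChar.compAddMonoidHom_apply, h1, ← AddChar.map_zero_eq_one (ZMod.stdAddChar (N := p))] at h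
  exact one_ne_zero (ZMod.injective_stdAddChar h)

lemma const_of_fourierCoeff_eq_zero {j : J} {y : (ι → ZMod p) → J → ℝ}
    (h : ∀ χ : ι → ZMod p, χ ≠ 0 → fourierCoeff χ j y = 0) (s t : ι → ZMod p) :
    y s j = y t j := by
  have key : ∀ s, (Fintype.card (ι → ZMod p) : ℂ) * y s j = fourierCoeff 0 j y := by
    intro s
    have h1 : ∑ χ : ι → ZMod p, fourierCoeff χ j y * ZMod.stdAddChar (dotProduct χ (-s)) =
        fourierCoeff 0 j y := by
      rw [Finset.sum_eq_single 0]
      · simp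
      · intro χ _ hχ; rw [h χ hχ, zero_mul]
      · simp
    have h2 : ∑ χ : ι → ZMod p, fourierCoeff χ j y * ZMod.stdAddChar (dotProduct χ (-s)) =
        ∑ t, (y t j : ℂ) * ∑ χ : ι → ZMod p, ZMod.stdAddChar (dotProduct χ (t - s)) := by
      simp only [fourierCoeff, Finset.sum_mul, Finset.mul_sum]
      rw [Finset.sum_comm]
      refine Finset.sum_congr rfl fun t _ => Finset.sum_congr rfl fun χ _ => ?_
      rw [mul_assoc, ← AddChar.map_add_eq_mul, ← dotProduct_add, sub_eq_add_neg]
    rw [← h1, h2, Finset.sum_eq_single s]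
    · simp [mul_comm]
    · intro t _ ht; rw [sum_stdAddChar_dotProduct (sub_ne_zero.2 ht), mul_zero]
    · simp
  have := (key s).trans (key t).symm
  have hc : (Fintype.card (ι → ZMod p) : ℂ) ≠ 0 := by
    exact_mod_cast Fintype.card_ne_zero
  exact_mod_cast mul_left_cancel₀ hc this

lemma continuous_fourierCoeff (χ : ι → ZMod p) (j : J) : Continuous (fourierCoeff χ j) := by
  unfold fourierCoeff; fun_prop

lemma fourierCoeff_im (hp2 : p = 2) (χ : ι → ZMod p) (j : J) (y : (ι → ZMod p) → J → ℝ) :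
    (fourierCoeff χ j y).im = 0 := by
  have h : -χ = χ := by subst hp2; ext i; simp
  have := fourierCoeff_neg χ j y
  rw [h] at this
  exact Complex.conj_eq_iff_im.1 this.symm

/-- The label of a tagged family of vectors determined by a Fourier coefficient. -/
noncomputable def fourierLabel (χ : ι → ZMod p) (j : J)
    (x : ((ι → ZMod p) → J → ℝ) × (ι → ZMod p)) : ZMod p :=
  if fourierCoeff χ j x.1 = 0 then dotProduct χ x.2 else sector p (fourierCoeff χ j x.1)

lemma fourierLabel_shift (χ : ι → ZMod p) (j : J) (g : ι → ZMod p)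
    (x : ((ι → ZMod p) → J → ℝ) × (ι → ZMod p)) :
    fourierLabel χ j (shift g x) = fourierLabel χ j x + dotProduct χ g := by
  have hne : (ZMod.stdAddChar (dotProduct χ g) : ℂ) ≠ 0 := by
    rw [ZMod.stdAddChar_apply]; exact Circle.coe_ne_zero _
  rw [fourierLabel, fourierLabel, fourierCoeff_shift]
  by_cases h : fourierCoeff χ j x.1 = 0
  · rw [h, zero_mul, if_pos rfl, if_pos rfl]
    exact dotProduct_add χ x.2 g
  · rw [if_neg h, if_neg (mul_ne_zero h hne), sector_mul_stdAddChar h]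

/-- A set of characters that represents all nontrivial ones up to sign. -/
lemma exists_half (p : ℕ) [Fact p.Prime] (ι : Type*) [Fintype ι] [DecidableEq ι] :
    ∃ S : Finset (ι → ZMod p), (∀ χ ∈ S, χ ≠ 0) ∧
    (∀ χ : ι → ZMod p, χ ≠ 0 → χ ∈ S ∨ -χ ∈ S) ∧
    stepDegree p * S.card ≤ Fintype.card (ι → ZMod p) - 1 := by
  by_cases hp2 : p = 2
  · refine ⟨Finset.univ.erase 0, by simp, by simp, ?_⟩
    rw [stepDegree, if_pos hp2, one_mul, Finset.card_erase_of_mem (Finset.mem_univ _),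
      Finset.card_univ]
  · let e := Fintype.equivFin (ι → ZMod p)
    have hne : ∀ χ : ι → ZMod p, χ ≠ 0 → -χ ≠ χ := fun χ hχ h => hχ <| by
      ext i
      have h1 := congrFun h i
      rw [Pi.neg_apply, neg_eq_iff_add_eq_zero, ← two_mul] at h1
      refine (mul_eq_zero.1 h1).resolve_left fun h2 => hp2 ?_
      have : p ∣ 2 := by rw [← CharP.cast_eq_zero_iff (ZMod p) p]; exact_mod_cast h2
      exact (Nat.prime_dvd_prime_iff_eq Fact.out Nat.prime_two).1 this
    refine ⟨Finset.univ.filter fun χ => e χ < e (-χ), ?_, ?_, ?_⟩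
    · rintro χ hχ rfl
      simp at hχ
    · intro χ hχ
      have := (e.injective.ne (hne χ hχ)).lt_or_gt
      simpa [or_comm] using this
    · set S := Finset.univ.filter fun χ : ι → ZMod p => e χ < e (-χ)
      have hdisj : Disjoint S (S.map (Equiv.neg _).toEmbedding) := by
        rw [Finset.disjoint_left]
        intro χ h1 h2
        simp only [S, Finset.mem_map_equiv, Finset.mem_filter, Finset.mem_univ, true_and,
          Equiv.neg_symm, Equiv.neg_apply, neg_neg] at h1 h2
        exact lt_asymm h1 h2
      have hsub : S ∪ S.map (Equiv.neg _).toEmbedding ⊆ Finset.univ.erase 0 := by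
        intro χ h
        rw [Finset.mem_erase]
        refine ⟨?_, Finset.mem_univ _⟩
        rintro rfl
        simp [S] at h
      have := Finset.card_le_card hsub
      rw [Finset.card_union_of_disjoint hdisj, Finset.card_map,
        Finset.card_erase_of_mem (Finset.mem_univ _), Finset.card_univ] at this
      rw [stepDegree, if_neg hp2]
      omega

/-- On a compact set of families that are not constant there are finitely many equivariant labels,
one of which is nearly constant on every small subset. -/
theorem exists_labels [Fintype J] {Q : Set ((ι → ZMod p) → J → ℝ)} (hQ : IsCompact Q)
    (hconst : ∀ y ∈ Q, ∃ s t, y s ≠ y t) :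
    ∃ L : List ((ι → ZMod p) × (((ι → ZMod p) → J → ℝ) × (ι → ZMod p) → ZMod p)),
      (∀ A ∈ L, ∀ g x, A.2 (shift g x) = A.2 x + dotProduct A.1 g) ∧ (∀ A ∈ L, A.1 ≠ 0) ∧
      stepDegree p * L.length ≤ (Fintype.card (ι → ZMod p) - 1) * Fintype.card J ∧
      ∃ ε > 0, ∀ l : List (((ι → ZMod p) → J → ℝ) × (ι → ZMod p)), l ≠ [] → (∀ x ∈ l, x.1 ∈ Q) →
        (∀ x ∈ l, ∀ x' ∈ l, dist x.1 x'.1 ≤ ε) → ∃ A ∈ L, NearConstant A.2 {x | x ∈ l} := by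
  obtain ⟨S, hS0, hS, hcard⟩ := exists_half p ι
  set L := ((S ×ˢ (Finset.univ : Finset J)).toList.map fun a => (a.1, fourierLabel a.1 a.2)) with hL
  have hmem : ∀ χ ∈ S, ∀ j : J, (χ, fourierLabel χ j) ∈ L := fun χ hχ j =>
    List.mem_map.2 ⟨(χ, j), by simp [hχ], rfl⟩
  have hloc : ∀ y : Q, ∃ U : Set ((ι → ZMod p) → J → ℝ), IsOpen U ∧ y.1 ∈ U ∧ ∃ A ∈ L, ∃ s : ZMod p,
      ∀ x : ((ι → ZMod p) → J → ℝ) × (ι → ZMod p), x.1 ∈ U → A.2 x = s ∨ p ≠ 2 ∧ A.2 x = s + 1 := by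
    rintro ⟨y, hy⟩
    have : ∃ χ ∈ S, ∃ j, fourierCoeff χ j y ≠ 0 := by
      by_contra! hzero
      obtain ⟨s, t, hst⟩ := hconst y hy
      refine hst (funext fun j => const_of_fourierCoeff_eq_zero (fun χ hχ => ?_) s t)
      rcases hS χ hχ with h | h
      · exact hzero χ h j
      · have := fourierCoeff_neg χ j y
        rw [hzero _ h j] at this
        exact (map_eq_zero (starRingEnd ℂ)).1 this.symm
    obtain ⟨χ, hχ, j, hne⟩ := this
    obtain ⟨s, hs⟩ := exists_sector_near (p := p) hne fun h => fourierCoeff_im h χ j y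
    obtain ⟨U, hU, hUo, hyU⟩ := eventually_nhds_iff.1
      ((continuous_fourierCoeff χ j).continuousAt.eventually hs)
    refine ⟨U, hUo, hyU, _, hmem χ hχ j, s, fun x hx => ?_⟩
    have := hU x.1 hx
    simp only [fourierLabel, if_neg this.1]
    exact this.2 fun h => fourierCoeff_im h χ j x.1
  choose U hUo hyU hU using hloc
  obtain ⟨δ, hδ, hball⟩ := lebesgue_number_lemma_of_metric hQ hUo
    fun y hy => Set.mem_iUnion.2 ⟨⟨y, hy⟩, hyU ⟨y, hy⟩⟩
  refine ⟨L, ?_, ?_, ?_, δ / 2, by positivity, ?_⟩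
  · intro A hA g x
    obtain ⟨a, -, rfl⟩ := List.mem_map.1 hA
    exact fourierLabel_shift a.1 a.2 g x
  · intro A hA
    obtain ⟨a, ha, rfl⟩ := List.mem_map.1 hA
    exact hS0 _ (by simpa using ha)
  · simp only [hL, List.length_map, Finset.length_toList, Finset.card_product, Finset.card_univ]
    rw [← mul_assoc]
    exact Nat.mul_le_mul_right _ hcard
  · intro l hl hlQ hld
    obtain ⟨x₀, hx₀⟩ := List.exists_mem_of_ne_nil l hl
    obtain ⟨y, hy⟩ := hball x₀.1 (hlQ x₀ hx₀)
    obtain ⟨A, hA, s, hs⟩ := hU y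
    refine ⟨A, hA, s, fun x hx => hs x (hy ?_)⟩
    rw [Metric.mem_ball]
    exact (hld x hx x₀ hx₀).trans_lt (by linarith)

end Fourier

section Equivariant

variable {p : ℕ} [hp : Fact p.Prime] {ι : Type*} [Fintype ι] [LinearOrder ι]

/-- A complex with commuting symmetries of order `p` that is acyclic up to level `N` receives a
chain map from a product of periodic resolutions. -/
lemma exists_chain_resolution {X : Type*} [DecidableEq X] {K : Set (Finset X)}
    {g : ι → X → X} (hgK : ∀ i, ∀ σ ∈ K, σ.image (g i) ∈ K)
    (hcomm : ∀ i j x, g i (g j x) = g j (g i x)) (hg : ∀ i x, (g i)^[p] x = x) {N : ℕ}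
    (hfill : ∀ m ≤ N, Fills (ZMod p) K m) {v : X} (hv : {v} ∈ K) :
    ∃ h : (ι →₀ ℕ) → Chain (ZMod p) X, IsResolution p g N h ∧
      ∀ a : ι →₀ ℕ, a.degree ≤ N → h a ∈ chainsOf (ZMod p) K (a.degree + 1) := by
  have hmapC : ∀ i n, ∀ z ∈ chainsOf (ZMod p) K n, map (g i) z ∈ chainsOf (ZMod p) K n := by
    intro i n z hz
    refine map_mem_on_of_single hz fun l hl => ?_
    rw [map_single]
    refine single_mem_on (Set.mem_ofPred_eq ▸ ⟨by simpa using hl.1, ?_⟩) 1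
    have := hgK i _ hl.2
    convert this using 1
    ext x
    simp
  have hpow : ∀ i, (map (g i) : Module.End (ZMod p) (Chain (ZMod p) X)) ^ p = 1 := by
    intro i
    refine hom_ext fun l => ?_
    rw [map_pow, map_single, funext (hg i)]
    simp
  obtain ⟨h, h0, h1⟩ := exists_resolution (ι := ι) (fun n => chainsOf (ZMod p) K n)
    (bd : Chain (ZMod p) X →ₗ[ZMod p] _) (fun i b => periodic p (map (g i)) b)
    (fun i b z => periodic_intertwine (F := ZMod p) (W := bd) (U := map (g i)) (U' := map (g i))
      (fun z => bd_map _ z) p b z)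
    (fun i b j b' z => periodic_comm (F := ZMod p) (U := map (g i)) (U' := map (g j))
      (fun z => by rw [map_map, map_map, show g i ∘ g j = g j ∘ g i from funext (hcomm i j)])
      p b b' z)
    (fun i b z => periodic_succ_periodic (hpow i) b z)
    (fun i b n z hz => by
      by_cases hb : Odd b
      · rw [periodic_of_odd hb]
        exact Submodule.sub_mem _ (hmapC i n z hz) hz
      · rw [periodic_of_even (Nat.not_odd_iff_even.1 hb)]
        refine Submodule.sum_mem _ fun s _ => ?_
        clear * - hmapC hz
        induction s with
        | zero => simpa using hz
        | succ s ih =>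
          rw [pow_succ', Module.End.mul_apply]
          exact hmapC i n _ ih)
    N hfill (Finsupp.single [v] 1)
    (single_mem_on (l := [v]) (S := {l | l.length = 0 + 1 ∧ l.toFinset ∈ K})
      ⟨rfl, by simpa using hv⟩ 1)
    (fun i => by
      rw [periodic_of_odd odd_one, bd_single_cons]
      simp [bd, bdList])
  exact ⟨h, ⟨⟨v, h0⟩, fun a ha ha0 => (h1 a ha).2 ha0⟩, fun a ha => (h1 a ha).1⟩

lemma IsResolution.map {X Y : Type*} {g : ι → X → X} {g' : ι → Y → Y} {N : ℕ}
    {h : (ι →₀ ℕ) → Chain (ZMod p) X} (hres : IsResolution p g N h) {φ : X → Y}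
    (hφ : ∀ i x, φ (g i x) = g' i (φ x)) :
    IsResolution p g' N fun a => ListChain.map φ (h a) := by
  obtain ⟨⟨v, hv⟩, h1⟩ := hres
  refine ⟨⟨φ v, by simp [hv]⟩, fun a ha ha0 => ?_⟩
  simp only [bd_map, h1 a ha ha0, map_sum, map_smul]
  refine Finset.sum_congr rfl fun i _ => ?_
  have := periodic_intertwine (F := ZMod p) (W := ListChain.map φ) (U := ListChain.map (g i))
    (U' := ListChain.map (g' i))
    (fun z => by rw [map_map, map_map, show φ ∘ g i = g' i ∘ φ from funext (hφ i)]) p (a i)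
    (h (a - Finsupp.single i 1))
  rw [this]

lemma barycenter_shift {G W : Type*} [AddCommGroup G] [Fintype G] [NormedAddCommGroup W]
    [NormedSpace ℝ W] (e : G) (x : (G → W) × G) (l : List ((G → W) × G)) :
    barycenter (shift e x) (l.map (shift e)) = shift e (barycenter x l) := by
  have hsum : ∀ l : List ((G → W) × G), ((l.map (shift e)).map Prod.fst).sum =
      fun s => (l.map Prod.fst).sum (s - e) := by
    intro l
    induction l with
    | nil => rfl
    | cons y l ih =>
      rw [List.map_cons, List.map_cons, List.sum_cons, ih]
      simp [shift, funext_iff]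
  have := hsum (x :: l)
  rw [List.map_cons] at this
  rw [barycenter, barycenter, this]
  simp [shift, funext_iff]

/-- Equivariant maps from complexes with enough acyclicity to families of vectors hit the constant
families. -/
theorem exists_const_of_fills {J : Type*} [Fintype J] {X : Type*} [DecidableEq X]
    {K : Set (Finset X)} (hK : K.Finite)
    {g : ι → X → X} (hgK : ∀ i, ∀ σ ∈ K, σ.image (g i) ∈ K)
    (hcomm : ∀ i j x, g i (g j x) = g j (g i x)) (hg : ∀ i x, (g i)^[p] x = x)
    (hfill : ∀ m ≤ (Fintype.card (ι → ZMod p) - 1) * Fintype.card J, Fills (ZMod p) K m)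
    {v : X} (hv : {v} ∈ K) {φ : X → ((ι → ZMod p) → J → ℝ) × (ι → ZMod p)}
    (hφ : ∀ i x, φ (g i x) = shift (Pi.single i 1) (φ x)) :
    ∃ σ ∈ K, ∃ y ∈ convexHull ℝ ((fun x => (φ x).1) '' (σ : Set X)), ∀ s t, y s = y t := by
  by_contra! hcon
  set N := (Fintype.card (ι → ZMod p) - 1) * Fintype.card J
  obtain ⟨h, hres, hmem⟩ := exists_chain_resolution hgK hcomm hg hfill hv
  set 𝒬 : Set (Set ((ι → ZMod p) → J → ℝ)) :=
    (fun σ : Finset X => convexHull ℝ ((fun x => (φ x).1) '' (σ : Set X))) '' K with h𝒬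
  set Q := ⋃₀ 𝒬 with hQdef
  have hQ : IsCompact Q := by
    refine (hK.image _).isCompact_sUnion ?_
    rintro _ ⟨σ, -, rfl⟩
    exact (σ.finite_toSet.image _).isCompact_convexHull ℝ
  obtain ⟨L, hL, hL0, hcard, ε, hε, hnear⟩ := exists_labels (p := p) hQ fun y hy => by
    obtain ⟨_, ⟨σ, hσ, rfl⟩, hy⟩ := hy
    exact hcon σ hσ y hy
  have hsm : ∀ a : ι →₀ ℕ, a.degree ≤ N →
      map φ (h a) ∈ on (ZMod p) (smallLists 𝒬 (Metric.diam Q) (a.degree + 1)) := by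
    intro a ha
    refine map_mem_on_of_single (hmem a ha) fun l hl => ?_
    rw [map_single]
    have hmemQ : ∀ x ∈ l.map φ, x.1 ∈ convexHull ℝ
        ((fun x => (φ x).1) '' (l.toFinset : Set X)) := by
      intro x hx
      obtain ⟨w, hw, rfl⟩ := List.mem_map.1 hx
      exact subset_convexHull ℝ _ ⟨w, by simpa using hw, rfl⟩
    have hS : convexHull ℝ ((fun x => (φ x).1) '' (l.toFinset : Set X)) ∈ 𝒬 := ⟨_, hl.2, rfl⟩
    exact single_mem_on (S := smallLists 𝒬 (Metric.diam Q) (a.degree + 1))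
      ⟨by simpa using hl.1, ⟨_, hS, hmemQ⟩, fun x hx y hy => Metric.dist_le_diam_of_mem hQ.isBounded
        ⟨_, hS, hmemQ x hx⟩ ⟨_, hS, hmemQ y hy⟩⟩ 1
  obtain ⟨h', hres', hsm'⟩ := exists_small_resolution
    (fun i x l => barycenter_shift (Pi.single i 1) x l)
    (by rintro _ ⟨σ, -, rfl⟩; exact convex_convexHull ℝ _) Metric.diam_nonneg (hres.map hφ) hsm hε
  refine not_forall_nearConstant (S := fun n => {l | l ∈ smallLists 𝒬 ε n ∧ n ≠ 0}) hres' L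
    (fun A hA i x => ?_) hL0 hcard (fun a ha => ?_) ?_
  · rw [hL A hA]
    simp
  · simpa using hsm' a ha
  · rintro n l ⟨⟨hlen, ⟨S, hS, hlS⟩, hdist⟩, hn⟩
    exact hnear l (fun h => hn (by rw [← hlen, h, List.length_nil])) (fun x hx => ⟨S, hS, hlS x hx⟩)
      hdist

end Equivariant

section Join

lemma exists_weights_of_mem_convexHull_image {X V : Type*} [AddCommGroup V] [Module ℝ V]
    {σ : Finset X} {f : X → V} {y : V} (hy : y ∈ convexHull ℝ (f '' (σ : Set X))) :
    ∃ w : X → ℝ, (∀ v ∈ σ, 0 ≤ w v) ∧ ∑ v ∈ σ, w v = 1 ∧ ∑ v ∈ σ, w v • f v = y := by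
  have hconv : Convex ℝ {y | ∃ w : X → ℝ, (∀ v ∈ σ, 0 ≤ w v) ∧ ∑ v ∈ σ, w v = 1 ∧
      ∑ v ∈ σ, w v • f v = y} := by
    rintro _ ⟨w, hw, hw1, rfl⟩ _ ⟨w', hw', hw1', rfl⟩ a b ha hb hab
    refine ⟨fun v => a * w v + b * w' v, fun v hv => ?_, ?_, ?_⟩
    · have := hw v hv
      have := hw' v hv
      positivity
    · rw [Finset.sum_add_distrib, ← Finset.mul_sum, ← Finset.mul_sum, hw1, hw1']
      linarith
    · simp only [add_smul, mul_smul, Finset.sum_add_distrib, Finset.smul_sum]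
  refine convexHull_min ?_ hconv hy
  rintro _ ⟨v, hv, rfl⟩
  have hv : v ∈ σ := hv
  refine ⟨Pi.single v 1, fun u _ => ?_, by simp [Finset.sum_pi_single', hv], ?_⟩
  · by_cases h : u = v
    · subst h; simp
    · simp [h]
  · simp [Pi.single_apply, hv]

/-- A constant point in the join of finitely many groups of points yields a common point of the
convex hulls of the groups. -/
lemma exists_common_point {X G : Type*} [Fintype G] [DecidableEq G] {d : ℕ} {σ : Finset X}
    {γ : X → G}
    {z : X → EuclideanSpace ℝ (Fin d)} {y : G → Fin (d + 1) → ℝ}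
    {f : X → G → Fin (d + 1) → ℝ} (hf : ∀ v, f v = Pi.single (γ v) (Fin.cons 1 (z v)))
    (hy : y ∈ convexHull ℝ (f '' (σ : Set X)))
    (hconst : ∀ s t, y s = y t) :
    ∃ x, ∀ s, x ∈ convexHull ℝ (z '' {v | v ∈ σ ∧ γ v = s}) := by
  obtain ⟨w, hw, hw1, hwy⟩ := exists_weights_of_mem_convexHull_image hy
  simp only [hf] at hwy
  have hys : ∀ s, y s = ∑ v ∈ σ with γ v = s, w v • (Fin.cons 1 (z v) : Fin (d + 1) → ℝ) := by
    intro s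
    rw [← hwy, Finset.sum_apply, Finset.sum_filter]
    refine Finset.sum_congr rfl fun v _ => ?_
    by_cases h : γ v = s
    · subst h; simp
    · rw [if_neg h, Pi.smul_apply, Pi.single_eq_of_ne (Ne.symm h), smul_zero]
  have hy0 : ∀ s, y s 0 = ∑ v ∈ σ with γ v = s, w v := by
    intro s
    simp [hys s]
  have hsum : ∑ s, y s 0 = 1 := by
    simp only [hy0]
    exact (Finset.sum_fiberwise σ γ w).trans hw1
  have hnonneg : ∀ s, 0 ≤ y s 0 := fun s => by
    rw [hy0]
    exact Finset.sum_nonneg fun v hv => hw v (Finset.mem_filter.1 hv).1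
  have hpos : ∀ s, 0 < y s 0 := fun s => by
    refine (hnonneg s).lt_of_ne fun h => ?_
    rw [Finset.sum_eq_zero fun t _ => by rw [hconst t s, ← h]] at hsum
    exact zero_ne_one hsum
  obtain ⟨s₀⟩ : Nonempty G := by
    by_contra h
    rw [not_nonempty_iff] at h
    simp at hsum
  refine ⟨(y s₀ 0)⁻¹ • WithLp.toLp 2 fun i => y s₀ i.succ, fun s => ?_⟩
  have hmem := Finset.centerMass_mem_convexHull (R := ℝ) (σ.filter (γ · = s)) (w := w) (z := z)
    (s := z '' {v | v ∈ σ ∧ γ v = s})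
    (fun v hv => hw v (Finset.mem_filter.1 hv).1) (by rw [← hy0]; exact hpos s)
    (fun v hv => ⟨v, Finset.mem_filter.1 hv, rfl⟩)
  convert hmem using 1
  rw [Finset.centerMass, ← hy0, hconst s₀ s]
  congr 1
  ext i
  simp [hys s]

end Join

section Tverberg

variable {p : ℕ} {ι : Type*} [DecidableEq ι] {R Y : Type*}

/-- The vertices of the chessboard complex are translated along the group component. -/
def translate (p : ℕ) (i : ι) (v : R × (Y × (ι → ZMod p))) : R × (Y × (ι → ZMod p)) :=
  (v.1, v.2.1, v.2.2 + Pi.single i 1)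

lemma translate_comm (i j : ι) (v : R × (Y × (ι → ZMod p))) :
    translate p i (translate p j v) = translate p j (translate p i v) := by
  simp only [translate, add_right_comm]

lemma iterate_translate (i : ι) (v : R × (Y × (ι → ZMod p))) : (translate p i)^[p] v = v := by
  have h : ∀ n : ℕ, (translate p i)^[n] v = (v.1, v.2.1, v.2.2 + n • Pi.single i 1) := by
    intro n
    induction n with
    | zero => simp
    | succ n ih => rw [Function.iterate_succ_apply', ih, translate, succ_nsmul, add_assoc]
  rw [h]
  have : (p • Pi.single i 1 : ι → ZMod p) = 0 := by
    ext j
    simp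
  rw [this, add_zero]

lemma image_translate_mem_chessboard [DecidableEq (R × (Y × (ι → ZMod p)))]
    [DecidableEq (Y × (ι → ZMod p))] {A : Finset R} {κ : R → ℕ} {τ : Y → ℕ} {c : ℕ} (i : ι)
    {σ : Finset (R × (Y × (ι → ZMod p)))}
    (hσ : σ ∈ chessboard A κ (fun t => τ t.1) (fun _ => c)) :
    σ.image (translate p i) ∈ chessboard A κ (fun t => τ t.1) (fun _ => c) := by
  obtain ⟨h1, h2, h3⟩ := hσ
  refine ⟨fun v hv => ?_, fun v hv w hw hvw => ?_, fun t => ?_⟩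
  · obtain ⟨v, hv', rfl⟩ := Finset.mem_image.1 hv
    exact h1 v hv'
  · obtain ⟨v, hv', rfl⟩ := Finset.mem_image.1 hv
    obtain ⟨w, hw', rfl⟩ := Finset.mem_image.1 hw
    rw [h2 v hv' w hw' hvw]
  · refine le_trans ?_ ((Finset.card_image_le (f := translate p i)).trans
      (h3 (t.1, t.2 - Pi.single i 1)))
    refine Finset.card_le_card fun v hv => ?_
    obtain ⟨hv, ht⟩ := Finset.mem_filter.1 hv
    obtain ⟨v, hv', rfl⟩ := Finset.mem_image.1 hv
    refine Finset.mem_image_of_mem _ (Finset.mem_filter.2 ⟨hv', ?_⟩)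
    rw [← ht]
    simp [translate]

/-- The vertex of the join of copies of affine space that is given by a point in one of the
copies. -/
noncomputable def joinVertex {d : ℕ} {G : Type*} [DecidableEq G]
    (v : EuclideanSpace ℝ (Fin d) × (Y × G)) : (G → Fin (d + 1) → ℝ) × G :=
  (Pi.single v.2.2 (Fin.cons 1 v.1), v.2.2)

lemma joinVertex_translate {d : ℕ} [DecidableEq (ι → ZMod p)] (i : ι)
    (v : EuclideanSpace ℝ (Fin d) × (Y × (ι → ZMod p))) :
    joinVertex (translate p i v) = shift (Pi.single i 1) (joinVertex v) := by
  simp only [joinVertex, translate, shift, Prod.mk.injEq, and_true]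
  funext s
  simp only [Pi.single_apply, sub_eq_iff_eq_add]

/-- Pairwise disjoint finite sets are the fibers of a numbering of their elements. -/
lemma exists_numbering {k : ℕ} {C : Fin k → Finset R}
    (hdisj : ∀ i j, i ≠ j → Disjoint (C i) (C j)) :
    ∃ κ : R → ℕ, ∀ i, ∀ x ∈ C i, κ x = i := by
  refine ⟨fun x => if h : ∃ i, x ∈ C i then (h.choose : ℕ) else 0, fun i x hx => ?_⟩
  have h : ∃ i, x ∈ C i := ⟨i, hx⟩
  change dite _ _ _ = _
  rw [dif_pos h]
  by_contra hne
  exact Finset.disjoint_left.1 (hdisj h.choose i fun e => hne (by rw [e])) h.choose_spec hx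

end Tverberg

lemma fills_equal_chessboard (F : Type*) [CommRing F] {R G : Type*} [DecidableEq R] [Fintype G]
    [DecidableEq G] {A : Finset R} {κ : R → ℕ} {k c N : ℕ} (hc : 0 < c)
    (hA : ∀ i < k, (c + 1) * Fintype.card G ≤ (A.filter (κ · = i)).card + 1)
    (hN : N < c * Fintype.card G * k) :
    ∀ m ≤ N, Fills F (chessboard A κ (fun t : Fin k × G => (t.1 : ℕ)) (fun _ => c)) m := by
  intro m hm
  refine fills_chessboard F A.card A κ _ _ rfl (fun j => ?_) m ?_
  · rw [Finset.sum_const, smul_eq_mul, demand, if_neg hc.ne']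
    by_cases hj : j < k
    · have h1 : (Finset.univ.filter fun t : Fin k × G => (t.1 : ℕ) = j) =
          {⟨j, hj⟩} ×ˢ Finset.univ := by
        ext t
        simp only [Finset.mem_filter, Finset.mem_univ, true_and, Finset.mem_product,
          Finset.mem_singleton, and_true, Fin.ext_iff]
      rw [h1, Finset.card_product, Finset.card_singleton, one_mul, Finset.card_univ, mul_comm]
      exact hA j hj
    · rw [Finset.filter_false_of_mem fun t _ (h : (t.1 : ℕ) = j) => hj (h ▸ t.1.2)]
      simp
  · rw [Finset.sum_const, Finset.card_univ, Fintype.card_prod, Fintype.card_fin, smul_eq_mul]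
    calc m ≤ N := hm
      _ < c * Fintype.card G * k := hN
      _ = k * Fintype.card G * c := by ring

lemma finite_chessboard {R T : Type*} [DecidableEq T] [Fintype T] {A : Finset R} {κ : R → ℕ}
    {τ c : T → ℕ} : (chessboard A κ τ c).Finite := by
  refine (A ×ˢ (Finset.univ : Finset T)).powerset.finite_toSet.subset fun σ hσ => ?_
  rw [Finset.mem_coe, Finset.mem_powerset]
  exact fun v hv => Finset.mem_product.2 ⟨(hσ.1 v hv).1, Finset.mem_univ _⟩

/-- A simplex of the chessboard complex is a colored family of disjoint groups. -/
lemma groups_of_mem_chessboard {R G : Type*} [DecidableEq R] [DecidableEq G] {A : Finset R}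
    {κ : R → ℕ} {k c : ℕ} {C : Fin k → Finset R} (hκ : ∀ i, ∀ x ∈ C i, κ x = i)
    {σ : Finset (R × (Fin k × G))}
    (hσ : σ ∈ chessboard A κ (fun t : Fin k × G => (t.1 : ℕ)) (fun _ => c)) :
    ∃ F : G → Finset R, (∀ s, F s ⊆ A) ∧ (∀ s t, s ≠ t → Disjoint (F s) (F t)) ∧
      (∀ s i, (F s ∩ C i).card ≤ c) ∧ ∀ s, (F s : Set R) = Prod.fst '' {v | v ∈ σ ∧ v.2.2 = s} := by
  obtain ⟨h1, h2, h3⟩ := hσ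
  refine ⟨fun s => (σ.filter (·.2.2 = s)).image Prod.fst, fun s z hz => ?_, fun s t hst => ?_,
    fun s i => ?_, fun s => by rw [Finset.coe_image, Finset.coe_filter]⟩
  · obtain ⟨v, hv, rfl⟩ := Finset.mem_image.1 hz
    exact (h1 v (Finset.mem_filter.1 hv).1).1
  · rw [Finset.disjoint_left]
    intro z hz hz'
    obtain ⟨v, hv, rfl⟩ := Finset.mem_image.1 hz
    obtain ⟨w, hw, hwv⟩ := Finset.mem_image.1 hz'
    rw [Finset.mem_filter] at hv hw
    have := h2 w hw.1 v hv.1 hwv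
    exact hst (by rw [← hv.2, ← hw.2, this])
  · refine le_trans (Finset.card_le_card fun z hz => ?_)
      ((Finset.card_image_le (f := Prod.fst)).trans (h3 (i, s)))
    obtain ⟨hz, hzi⟩ := Finset.mem_inter.1 hz
    obtain ⟨v, hv, rfl⟩ := Finset.mem_image.1 hz
    rw [Finset.mem_filter] at hv
    refine Finset.mem_image_of_mem _ (Finset.mem_filter.2 ⟨hv.1, Prod.ext (Fin.ext ?_) hv.2⟩)
    exact (h1 v hv.1).2.symm.trans (hκ i _ hzi)

lemma exists_common_point_of_fills {p d : ℕ} [hp : Fact p.Prime] {ι Y : Type*} [Fintype ι]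
    [LinearOrder ι] [Fintype Y] [DecidableEq Y] {A : Finset (EuclideanSpace ℝ (Fin d))}
    {κ : EuclideanSpace ℝ (Fin d) → ℕ} {τ : Y → ℕ} {c : ℕ}
    (hfill : ∀ m ≤ (Fintype.card (ι → ZMod p) - 1) * (d + 1),
      Fills (ZMod p) (chessboard A κ (fun t : Y × (ι → ZMod p) => τ t.1) (fun _ => c)) m)
    {v : EuclideanSpace ℝ (Fin d) × (Y × (ι → ZMod p))}
    (hv : {v} ∈ chessboard A κ (fun t : Y × (ι → ZMod p) => τ t.1) (fun _ => c)) :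
    ∃ σ ∈ chessboard A κ (fun t : Y × (ι → ZMod p) => τ t.1) (fun _ => c),
      ∃ x, ∀ s, x ∈ convexHull ℝ (Prod.fst '' {v | v ∈ σ ∧ v.2.2 = s}) := by
  obtain ⟨σ, hσ, y, hy, hconst⟩ := exists_const_of_fills (J := Fin (d + 1)) finite_chessboard
    (g := translate p) (fun i σ hσ => image_translate_mem_chessboard i hσ) translate_comm
    iterate_translate (by rwa [Fintype.card_fin]) hv (φ := joinVertex) joinVertex_translate
  exact ⟨σ, hσ, exists_common_point
    (γ := fun v : EuclideanSpace ℝ (Fin d) × Y × (ι → ZMod p) => v.2.2) (z := Prod.fst)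
    (f := fun v => (joinVertex v).1) (fun _ => rfl) hy hconst⟩

/-- The colored Tverberg theorem with groups indexed by an elementary abelian group. -/
theorem exists_colored_partition {p d k : ℕ} [hp : Fact p.Prime] {ι : Type*} [Fintype ι]
    [LinearOrder ι] (hk : 1 ≤ k)
    (hineq : (Fintype.card (ι → ZMod p) - 1) * (d + 1) + 1 ≤ p * Fintype.card (ι → ZMod p) * k)
    (C : Fin k → Finset (EuclideanSpace ℝ (Fin d)))
    (hdisj : ∀ i j : Fin k, i ≠ j → Disjoint (C i) (C j))
    (hcard : ∀ i, (C i).card = (p + 1) * Fintype.card (ι → ZMod p) - 1) :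
    ∃ F : (ι → ZMod p) → Finset (EuclideanSpace ℝ (Fin d)),
      (∀ s, F s ⊆ Finset.univ.biUnion C) ∧ (∀ s t, s ≠ t → Disjoint (F s) (F t)) ∧
      (∀ s i, (F s ∩ C i).card ≤ p) ∧
      ∃ x, ∀ s, x ∈ convexHull ℝ (F s : Set (EuclideanSpace ℝ (Fin d))) := by
  obtain ⟨κ, hκ⟩ := exists_numbering hdisj
  set A := Finset.univ.biUnion C with hA
  set r := Fintype.card (ι → ZMod p)
  have hp0 := hp.out.pos
  have hr : 1 ≤ r := Fintype.card_pos
  have hfiber : ∀ i, A.filter (κ · = (i : Fin k)) = C i := by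
    intro i
    ext x
    simp only [hA, Finset.mem_filter, Finset.mem_biUnion, Finset.mem_univ, true_and]
    constructor
    · rintro ⟨⟨j, hj⟩, hx⟩
      rw [hκ j x hj] at hx
      rwa [← Fin.ext hx]
    · exact fun hx => ⟨⟨i, hx⟩, hκ i x hx⟩
  set K := chessboard A κ (fun t : Fin k × (ι → ZMod p) => (t.1 : ℕ)) (fun _ => p) with hK
  have hfill : ∀ m ≤ (r - 1) * (d + 1), Fills (ZMod p) K m := by
    refine fills_equal_chessboard (ZMod p) hp0 (fun j hj => ?_) ?_
    · have h := hfiber ⟨j, hj⟩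
      dsimp only at h
      rw [h, hcard]
      change (p + 1) * r ≤ _
      omega
    · exact hineq
  obtain ⟨x₀, hx₀⟩ : (C ⟨0, hk⟩).Nonempty := by
    rw [← Finset.card_pos, hcard]
    have : 2 * 1 ≤ (p + 1) * r := Nat.mul_le_mul (by omega) hr
    omega
  have hv : {(x₀, (⟨0, hk⟩ : Fin k), (0 : ι → ZMod p))} ∈ K := by
    refine ⟨?_, ?_, fun t => (Finset.card_filter_le _ _).trans ?_⟩
    · simp only [Finset.mem_singleton, forall_eq]
      exact ⟨Finset.mem_biUnion.2 ⟨_, Finset.mem_univ _, hx₀⟩, hκ _ _ hx₀⟩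
    · simp
    · rwa [Finset.card_singleton]
  obtain ⟨σ, hσ, x, hx⟩ := exists_common_point_of_fills hfill hv
  obtain ⟨F, h1, h2, h3, hF⟩ := groups_of_mem_chessboard hκ hσ
  exact ⟨F, h1, h2, h3, x, fun s => by rw [hF]; exact hx s⟩

end ListChain

theorem colored_tverberg_with_multiplicities
    (p α r d k : ℕ) (hp : p.Prime) (hα : 1 ≤ α) (hr : r = p ^ α)
    (hd : 1 ≤ d) (hk : 1 ≤ k)
    (hineq : (r - 1) * (d + 1) + 1 ≤ p * r * k)
    (C : Fin k → Finset (EuclideanSpace ℝ (Fin d)))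
    (hdisj : ∀ i j : Fin k, i ≠ j → Disjoint (C i) (C j))
    (hcard : ∀ i, (C i).card = (p + 1) * r - 1) :
    ∃ F : Fin r → Finset (EuclideanSpace ℝ (Fin d)),
      (∀ s, F s ⊆ Finset.univ.biUnion C) ∧
      (∀ s t : Fin r, s ≠ t → Disjoint (F s) (F t)) ∧
      (∀ s i, (F s ∩ C i).card ≤ p) ∧
      (⋂ s, convexHull ℝ (↑(F s) : Set (EuclideanSpace ℝ (Fin d)))).Nonempty := by
  have := Fact.mk hp
  have hr' : Fintype.card (Fin α → ZMod p) = r := by simp [ZMod.card, hr]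
  obtain ⟨F, h1, h2, h3, x, hx⟩ := ListChain.exists_colored_partition (p := p) (ι := Fin α) hk
    (by rwa [hr']) C hdisj (by rwa [hr'])
  let e : Fin r ≃ (Fin α → ZMod p) := (Fintype.equivFinOfCardEq hr').symm
  exact ⟨fun s => F (e s), fun s => h1 _, fun s t hst => h2 _ _ (e.injective.ne hst),
    fun s => h3 _, x, Set.mem_iInter.2 fun s => hx _⟩
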